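/- arXiv:1403.0177 — 3 statements merged into one kernel-verified Lean document; each statement's English description precedes it below -/
import Mathlib

section
/- For every δ ∈ (0, 1/4) there is a constant C_δ such that for every z ∈ ℂ with Re z = 1/4 − δ and every (ξ, η) ∈ ℝ², the principal value integral m_z(ξ,η) = p.v. ∫_ℝ e^{−2πi(ξt + ηγ(t))} (1 + η²γ(t)²)^z dt/t converges and |m_z(ξ,η)| ≤ C_δ (1 + |Im z|). -/
open MeasureTheory Topology Filter

/-- A nonnegative, nondecreasing, convex function `g` on `(0, ∞)` with derivatives `g₁`, `g₂`. -/
structure IsConvexCurve (g g₁ g₂ : ℝ → ℝ) : Prop where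
  hasDerivAt : ∀ t, 0 < t → HasDerivAt g (g₁ t) t
  hasDerivAt_deriv : ∀ t, 0 < t → HasDerivAt g₁ (g₂ t) t
  nonneg : ∀ t, 0 < t → 0 ≤ g t
  deriv_nonneg : ∀ t, 0 < t → 0 ≤ g₁ t
  deriv_deriv_nonneg : ∀ t, 0 < t → 0 ≤ g₂ t

lemma isConvexCurve_zero : IsConvexCurve 0 0 0 :=
  ⟨fun t _ => hasDerivAt_const t 0, fun t _ => hasDerivAt_const t 0, fun _ _ => le_rfl,
    fun _ _ => le_rfl, fun _ _ => le_rfl⟩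

/-- The complex power `(1 + x²)^z`. -/
noncomputable def amplitude (z : ℂ) (x : ℝ) : ℂ := ((1 + x ^ 2 : ℝ) : ℂ) ^ z

/-- The oscillatory integrand `e^{iσ(ξt + g(t))} (1 + g(t)²)^z / t`. -/
noncomputable def oscIntegrand (σ ξ : ℝ) (z : ℂ) (g : ℝ → ℝ) (t : ℝ) : ℂ :=
  Complex.exp (((σ * (ξ * t + g t) : ℝ) : ℂ) * Complex.I) * amplitude z (g t) / (t : ℂ)

lemma norm_amplitude (z : ℂ) (x : ℝ) : ‖amplitude z x‖ = (1 + x ^ 2) ^ z.re :=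
  Complex.norm_cpow_eq_rpow_re_of_pos (by positivity) z

lemma norm_oscIntegrand (σ ξ : ℝ) (z : ℂ) (g : ℝ → ℝ) {t : ℝ} (ht : 0 < t) :
    ‖oscIntegrand σ ξ z g t‖ = (1 + g t ^ 2) ^ z.re / t := by
  rw [oscIntegrand, norm_div, norm_mul, Complex.norm_exp_ofReal_mul_I, norm_amplitude, one_mul,
    Complex.norm_real, Real.norm_of_nonneg ht.le]

lemma hasDerivAt_amplitude_comp (z : ℂ) {g : ℝ → ℝ} {g' t : ℝ} (hg : HasDerivAt g g' t) :
    HasDerivAt (fun s => amplitude z (g s))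
      (z * amplitude (z - 1) (g t) * ((2 * g t * g' : ℝ) : ℂ)) t := by
  have h1 : HasDerivAt (fun s => 1 + g s ^ 2) (2 * g t * g') t := by
    simpa using (hg.pow 2).const_add 1
  have h2 : HasDerivAt (fun w : ℂ => w ^ z)
      (z * ((1 + g t ^ 2 : ℝ) : ℂ) ^ (z - 1) * 1) ((1 + g t ^ 2 : ℝ) : ℂ) :=
    (hasDerivAt_id _).cpow_const
      (Complex.ofReal_mem_slitPlane.2 (by positivity))
  have h3 := HasDerivAt.comp t h2 h1.ofReal_comp
  simpa [amplitude, Function.comp_def] using h3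

lemma hasDerivAt_one_add_sq_rpow (a : ℝ) {g : ℝ → ℝ} {g' t : ℝ} (hg : HasDerivAt g g' t) :
    HasDerivAt (fun s => (1 + g s ^ 2) ^ a)
      (a * (1 + g t ^ 2) ^ (a - 1) * (2 * g t * g')) t := by
  have h1 : HasDerivAt (fun s => 1 + g s ^ 2) (2 * g t * g') t := by
    simpa using (hg.pow 2).const_add 1
  have := h1.rpow_const (p := a) (Or.inl (by positivity))
  convert this using 1
  ring

lemma IsConvexCurve.continuousOn_oscIntegrand {g g₁ g₂ : ℝ → ℝ} (h : IsConvexCurve g g₁ g₂)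
    (σ ξ : ℝ) (z : ℂ) : ContinuousOn (oscIntegrand σ ξ z g) (Set.Ioi 0) := by
  intro t ht
  have hg := h.hasDerivAt t ht
  have h1 := (hasDerivAt_amplitude_comp z hg).continuousAt
  have h2 := hg.continuousAt
  have ht' : (t : ℂ) ≠ 0 := by exact_mod_cast (ne_of_gt ht)
  refine ContinuousAt.continuousWithinAt ?_
  unfold oscIntegrand
  refine ContinuousAt.div (ContinuousAt.mul ?_ h1) Complex.continuous_ofReal.continuousAt ht'
  fun_prop

/-- Integration by parts for an oscillatory integral whose phase has a nonvanishing monotone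
derivative; the error is controlled by the increment of a primitive `Q`. -/
lemma IsConvexCurve.norm_integral_le {g g₁ g₂ : ℝ → ℝ} (h : IsConvexCurve g g₁ g₂)
    {α β σ ξ : ℝ} {z : ℂ} (hα : 0 < α) (hαβ : α ≤ β) (hσ : 1 ≤ |σ|) (hz : 0 < z.re)
    (hp : ∀ t ∈ Set.Icc α β, ξ + g₁ t ≠ 0) {Q Q' : ℝ → ℝ}
    (hQ : ∀ t ∈ Set.Icc α β, HasDerivAt Q (Q' t) t)
    (hQ' : ∀ t ∈ Set.Icc α β, (2 + ‖z‖ / z.re) *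
      (z.re * (1 + g t ^ 2) ^ (z.re - 1) * (2 * g t * g₁ t) / t + (1 + g t ^ 2) ^ z.re / t ^ 2) /
        |ξ + g₁ t| ≤ Q' t) :
    ‖∫ t in α..β, oscIntegrand σ ξ z g t‖ ≤
      2 * ((1 + g α ^ 2) ^ z.re / (α * |ξ + g₁ α|)) +
        2 * ((1 + g β ^ 2) ^ z.re / (β * |ξ + g₁ β|)) + (Q β - Q α) := by
  have hpos : ∀ t ∈ Set.Icc α β, 0 < t := fun t ht => hα.trans_le ht.1
  set p : ℝ → ℝ := fun t => ξ + g₁ t with hpdef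
  set κ : ℂ := (σ : ℂ) * Complex.I with hκ
  have hσ0 : σ ≠ 0 := by rintro rfl; norm_num at hσ
  have hκ0 : κ ≠ 0 := by simp [hκ, hσ0]
  have hκn : 1 ≤ ‖κ‖ := by simpa [hκ] using hσ
  set e : ℝ → ℂ := fun t => Complex.exp (((σ * (ξ * t + g t) : ℝ) : ℂ) * Complex.I) with he
  have hen : ∀ t, ‖e t‖ = 1 := fun t => Complex.norm_exp_ofReal_mul_I _
  set B : ℝ → ℝ := fun t => (1 + g t ^ 2) ^ z.re with hB
  set B' : ℝ → ℝ := fun t => z.re * (1 + g t ^ 2) ^ (z.re - 1) * (2 * g t * g₁ t) with hB'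
  set A : ℝ → ℂ := fun t => amplitude z (g t) with hA
  set A' : ℝ → ℂ := fun t => z * amplitude (z - 1) (g t) * ((2 * g t * g₁ t : ℝ) : ℂ) with hA'
  have hBpos : ∀ t, 0 < B t := fun t => by simp only [hB]; positivity
  have hAn : ∀ t, ‖A t‖ = B t := fun t => norm_amplitude _ _
  have hA'n : ∀ t ∈ Set.Icc α β, ‖A' t‖ = ‖z‖ / z.re * B' t := by
    intro t ht
    have h0 := h.nonneg t (hpos t ht)
    have h1 := h.deriv_nonneg t (hpos t ht)
    have : 0 ≤ 2 * g t * g₁ t := by positivity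
    simp only [hA', hB', norm_mul, norm_amplitude, Complex.norm_real, Real.norm_of_nonneg this,
      Complex.sub_re, Complex.one_re]
    field_simp
  have hB'n : ∀ t ∈ Set.Icc α β, 0 ≤ B' t := by
    intro t ht
    have h0 := h.nonneg t (hpos t ht)
    have h1 := h.deriv_nonneg t (hpos t ht)
    simp only [hB']; positivity
  have hdp : ∀ t ∈ Set.Icc α β, HasDerivAt (fun s => s * p s) (p t + t * g₂ t) t := by
    intro t ht
    have := (hasDerivAt_id' t).fun_mul ((h.hasDerivAt_deriv t (hpos t ht)).const_add ξ)
    simpa [hpdef] using this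
  have hde : ∀ t ∈ Set.Icc α β, HasDerivAt e (e t * (κ * p t)) t := by
    intro t ht
    have h1 : HasDerivAt (fun s => σ * (ξ * s + g s)) (σ * p t) t := by
      have := ((((hasDerivAt_id t).const_mul ξ).add (h.hasDerivAt t (hpos t ht))).const_mul σ)
      simpa [hpdef] using this
    have h2 := (h1.ofReal_comp.mul_const Complex.I).cexp
    convert h2 using 1
    simp only [he, hκ]; push_cast; ring
  set v : ℝ → ℂ := fun t => A t / ((t * p t : ℝ) : ℂ) with hv
  set v' : ℝ → ℂ := fun t => (A' t * ((t * p t : ℝ) : ℂ) - A t * ((p t + t * g₂ t : ℝ) : ℂ)) /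
    ((t * p t : ℝ) : ℂ) ^ 2 with hv'
  have htp : ∀ t ∈ Set.Icc α β, t * p t ≠ 0 := fun t ht =>
    mul_ne_zero (hpos t ht).ne' (hp t ht)
  have hdv : ∀ t ∈ Set.Icc α β, HasDerivAt v (v' t) t := by
    intro t ht
    exact (hasDerivAt_amplitude_comp z (h.hasDerivAt t (hpos t ht))).div
      (hdp t ht).ofReal_comp (by exact_mod_cast htp t ht)
  set Ψ : ℝ → ℝ := fun t => B α / (α * p α) - B t / (t * p t) + (Q t - Q α) with hΨ
  set Ψ' : ℝ → ℝ := fun t => -((B' t * (t * p t) - B t * (p t + t * g₂ t)) / (t * p t) ^ 2) + Q' t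
    with hΨ'
  have hdΨ : ∀ t ∈ Set.Icc α β, HasDerivAt Ψ (Ψ' t) t := by
    intro t ht
    exact (((hasDerivAt_one_add_sq_rpow z.re (h.hasDerivAt t (hpos t ht))).div (hdp t ht)
      (htp t ht)).const_sub _).add ((hQ t ht).sub_const _)
  have hcont := h.continuousOn_oscIntegrand σ ξ z
  have hii : ∀ t, 0 < t → IntervalIntegrable (oscIntegrand σ ξ z g) volume α t := by
    intro t ht
    refine (hcont.mono fun s hs => ?_).intervalIntegrable
    exact (lt_min hα ht).trans_le hs.1
  have hdI : ∀ t ∈ Set.Icc α β, HasDerivAt (fun u => ∫ s in α..u, oscIntegrand σ ξ z g s)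
      (oscIntegrand σ ξ z g t) t := by
    intro t ht
    refine intervalIntegral.integral_hasDerivAt_right (hii t (hpos t ht)) ?_
      (hcont.continuousAt (Ioi_mem_nhds (hpos t ht)))
    exact hcont.stronglyMeasurableAtFilter isOpen_Ioi t (hpos t ht)
  set H : ℝ → ℂ := fun t => (∫ s in α..t, oscIntegrand σ ξ z g s) - e t * v t / κ + e α * v α / κ
    with hH
  have hdH : ∀ t ∈ Set.Icc α β, HasDerivAt H (-(e t * v' t) / κ) t := by
    intro t ht
    have h1 := ((hdI t ht).sub (((hde t ht).mul (hdv t ht)).div_const κ)).add_const (e α * v α / κ)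
    refine h1.congr_deriv ?_
    have hp' : (p t : ℂ) ≠ 0 := by exact_mod_cast hp t ht
    have ht' : (t : ℂ) ≠ 0 := by exact_mod_cast (hpos t ht).ne'
    have h2 : oscIntegrand σ ξ z g t = e t * (κ * p t) * v t / κ := by
      simp only [oscIntegrand, he, hv, hA]
      push_cast
      field_simp
    rw [h2]; ring
  have hmain : ‖H β‖ ≤ Ψ β := by
    refine image_norm_le_of_norm_deriv_right_le_deriv_boundary' (f' := fun t => -(e t * v' t) / κ)
      (B' := Ψ') (a := α) (b := β)
      (fun t ht => (hdH t ht).continuousAt.continuousWithinAt)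
      (fun t ht => (hdH t (Set.Ico_subset_Icc_self ht)).hasDerivWithinAt) ?_
      (fun t ht => (hdΨ t ht).continuousAt.continuousWithinAt)
      (fun t ht => (hdΨ t (Set.Ico_subset_Icc_self ht)).hasDerivWithinAt) ?_
      (Set.right_mem_Icc.2 hαβ)
    · simp [hH, hΨ]
    · intro t ht
      replace ht := Set.Ico_subset_Icc_self ht
      have ht0 := hpos t ht
      have hp0 : 0 < |p t| := abs_pos.2 (hp t ht)
      have hg2 := h.deriv_deriv_nonneg t ht0
      have hb := hBpos t
      have hb' := hB'n t ht
      have e1 : ‖-(e t * v' t) / κ‖ ≤ ‖v' t‖ := by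
        rw [norm_div, norm_neg, norm_mul, hen, one_mul]
        exact div_le_self (norm_nonneg _) hκn
      have e2 : ‖v' t‖ ≤ (‖z‖ / z.re * B' t * (t * |p t|) + B t * (|p t| + t * g₂ t)) /
          (t * |p t|) ^ 2 := by
        simp only [hv', norm_div, norm_pow, Complex.norm_real, Real.norm_eq_abs, abs_mul,
          abs_of_pos ht0]
        gcongr
        refine (norm_sub_le _ _).trans ?_
        rw [norm_mul (A' t), norm_mul (A t), hA'n t ht, hAn, Complex.norm_real, Complex.norm_real,
          Real.norm_eq_abs, Real.norm_eq_abs, abs_mul, abs_of_pos ht0]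
        gcongr
        refine (abs_add_le _ _).trans ?_
        rw [abs_mul, abs_of_pos ht0, abs_of_nonneg hg2]
      have e3 := hQ' t ht
      change _ * (B' t / t + B t / t ^ 2) / |p t| ≤ _ at e3
      have e4 : -(B' t / (t * |p t|) + B t / (t ^ 2 * |p t|)) ≤ -((B' t * (t * p t) - B t * p t) /
          (t * p t) ^ 2) := by
        have : (B' t * (t * p t) - B t * p t) / (t * p t) ^ 2
            = B' t / (t * p t) - B t / (t ^ 2 * p t) := by
          have := hp t ht
          change p t ≠ 0 at this
          field_simp
        rw [this]
        rcases abs_cases (p t) with ⟨h1, -⟩ | ⟨h1, -⟩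
        · rw [h1]
          have : 0 ≤ B t / (t ^ 2 * p t) := by rw [← h1]; positivity
          linarith
        · have hpe : p t = -|p t| := by linarith
          have f1 : B' t / (t * p t) = - (B' t / (t * |p t|)) := by
            rw [h1]; rw [mul_neg, div_neg, neg_neg]
          have f2 : B t / (t ^ 2 * p t) = - (B t / (t ^ 2 * |p t|)) := by
            rw [h1]; rw [mul_neg, div_neg, neg_neg]
          have : 0 ≤ B' t / (t * |p t|) := by positivity
          rw [f1, f2]
          linarith
      have e5 : Ψ' t = -((B' t * (t * p t) - B t * p t) / (t * p t) ^ 2) +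
          B t * g₂ t / (t * |p t| ^ 2) + Q' t := by
        simp only [hΨ', sq_abs]
        have := hp t ht
        change p t ≠ 0 at this
        field_simp
        ring
      have e6 : (‖z‖ / z.re * B' t * (t * |p t|) + B t * (|p t| + t * g₂ t)) / (t * |p t|) ^ 2 =
          ‖z‖ / z.re * (B' t / (t * |p t|)) + B t / (t ^ 2 * |p t|) +
            B t * g₂ t / (t * |p t| ^ 2) := by
        field_simp
        ring
      have e7 : (2 + ‖z‖ / z.re) * (B' t / t + B t / t ^ 2) / |p t| =
          (2 + ‖z‖ / z.re) * (B' t / (t * |p t|) + B t / (t ^ 2 * |p t|)) := by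
        field_simp
      have e8 : 0 ≤ ‖z‖ / z.re * (B t / (t ^ 2 * |p t|)) := by positivity
      have e9 : 0 ≤ B' t / (t * |p t|) := by positivity
      rw [e7] at e3
      rw [e6] at e2
      linarith
  have hEv : ∀ t ∈ Set.Icc α β, ‖e t * v t / κ‖ ≤ B t / (t * |p t|) := by
    intro t ht
    rw [norm_div, norm_mul, hen, one_mul]
    refine (div_le_self (norm_nonneg _) hκn).trans ?_
    simp only [hv, norm_div, hAn, Complex.norm_real, Real.norm_eq_abs, abs_mul,
      abs_of_pos (hpos t ht), le_refl]
  have hab : ∀ t ∈ Set.Icc α β, |B t / (t * p t)| = B t / (t * |p t|) := by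
    intro t ht
    rw [abs_div, abs_mul, abs_of_pos (hpos t ht), abs_of_pos (hBpos t)]
  have ha := Set.left_mem_Icc.2 hαβ
  have hb := Set.right_mem_Icc.2 hαβ
  have h1 : (∫ s in α..β, oscIntegrand σ ξ z g s) = H β + e β * v β / κ - e α * v α / κ := by
    simp only [hH]; ring
  rw [h1]
  refine (norm_sub_le _ _).trans ?_
  have h2 := norm_add_le (H β) (e β * v β / κ)
  have h3 := hEv α ha
  have h4 := hEv β hb
  have h5 := le_abs_self (B α / (α * p α))
  have h6 := neg_abs_le (B β / (β * p β))
  rw [hab α ha] at h5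
  rw [hab β hb] at h6
  have h7 : Ψ β = B α / (α * p α) - B β / (β * p β) + (Q β - Q α) := rfl
  change _ ≤ 2 * (B α / (α * |p α|)) + 2 * (B β / (β * |p β|)) + (Q β - Q α)
  linarith

/-- A positive convex curve on `(0, ∞)` vanishing at the origin, whose derivative grows at least
like a power of `t`. -/
structure IsGrowingCurve (g g₁ g₂ : ℝ → ℝ) (b : ℝ) : Prop extends IsConvexCurve g g₁ g₂ where
  rate_pos : 0 < b
  rate_le_one : b ≤ 1
  pos : ∀ t, 0 < t → 0 < g t
  le_mul_deriv : ∀ t, 0 < t → g t ≤ t * g₁ t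
  chord_le : ∀ s t, 0 < s → s ≤ t → t * g s ≤ s * g t
  growth : ∀ t, 0 < t → b * g₁ t ≤ t * g₂ t

namespace IsGrowingCurve

variable {g g₁ g₂ : ℝ → ℝ} {b : ℝ}

lemma deriv_pos (h : IsGrowingCurve g g₁ g₂ b) {t : ℝ} (ht : 0 < t) : 0 < g₁ t :=
  pos_of_mul_pos_right ((h.pos t ht).trans_le (h.le_mul_deriv t ht)) ht.le

lemma mono (h : IsGrowingCurve g g₁ g₂ b) {s t : ℝ} (hs : 0 < s) (hst : s ≤ t) : g s ≤ g t := by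
  have h1 := h.chord_le s t hs hst
  have h2 := h.pos t (hs.trans_le hst)
  have : t * g s ≤ t * g t := h1.trans (by gcongr)
  exact le_of_mul_le_mul_left this (hs.trans_le hst)

lemma exists_slope (h : IsGrowingCurve g g₁ g₂ b) {s t : ℝ} (hs : 0 < s) (hst : s < t) :
    ∃ u ∈ Set.Ioo s t, g₂ u * (t - s) = g₁ t - g₁ s := by
  obtain ⟨u, hu, hu'⟩ := exists_hasDerivAt_eq_slope g₁ g₂ hst
    (fun x hx => (h.hasDerivAt_deriv x (hs.trans_le hx.1)).continuousAt.continuousWithinAt)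
    (fun x hx => h.hasDerivAt_deriv x (hs.trans hx.1))
  refine ⟨u, hu, ?_⟩
  rw [hu', div_mul_cancel₀ _ (sub_pos.2 hst).ne']

lemma deriv_mono (h : IsGrowingCurve g g₁ g₂ b) {s t : ℝ} (hs : 0 < s) (hst : s ≤ t) :
    g₁ s ≤ g₁ t := by
  rcases hst.eq_or_lt with rfl | hst
  · rfl
  obtain ⟨u, hu, hu'⟩ := h.exists_slope hs hst
  have := mul_nonneg (h.deriv_deriv_nonneg u (hs.trans hu.1)) (sub_pos.2 hst).le
  linarith

/-- The quantitative growth of the derivative between two points. -/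
lemma gap (h : IsGrowingCurve g g₁ g₂ b) {s t : ℝ} (hs : 0 < s) (hst : s ≤ t) :
    b / 2 * (t - s) * g₁ t ≤ t * (g₁ t - g₁ s) := by
  rcases hst.eq_or_lt with rfl | hst
  · simp
  obtain ⟨u, hu, hu'⟩ := h.exists_slope hs hst
  have hb := h.rate_pos
  have hu0 := hs.trans hu.1
  have h1 : b * g₁ s ≤ t * g₂ u :=
    calc b * g₁ s ≤ b * g₁ u := by have := h.deriv_mono hs hu.1.le; gcongr
      _ ≤ u * g₂ u := h.growth u hu0
      _ ≤ t * g₂ u := by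
        have := h.deriv_deriv_nonneg u hu0
        have := hu.2.le
        gcongr
  have h2 : b * g₁ s * (t - s) ≤ t * (g₁ t - g₁ s) := by
    rw [← hu', ← mul_assoc]
    have := sub_pos.2 hst
    gcongr
  have h3 : b * (t - s) ≤ t := by nlinarith [h.rate_le_one]
  have h4 : 0 ≤ g₁ t - g₁ s := sub_nonneg.2 (h.deriv_mono hs hst.le)
  nlinarith

lemma exists_deriv_eq (h : IsGrowingCurve g g₁ g₂ b) {N : ℝ} (hN : 0 < N) :
    ∃ c, 0 < c ∧ g₁ c = N := by
  have hb := h.rate_pos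
  have hb1 := h.rate_le_one
  have hq : 0 < 1 - b / 4 := by linarith
  have hstep : ∀ t, 0 < t → g₁ (t / 2) ≤ (1 - b / 4) * g₁ t := by
    intro t ht
    have h1 := h.gap (half_pos ht) (half_le_self ht.le)
    have : t * (b / 4 * g₁ t) ≤ t * (g₁ t - g₁ (t / 2)) := by linarith
    have := le_of_mul_le_mul_left this ht
    linarith
  have hsmall : ∀ n : ℕ, g₁ ((1 / 2) ^ n) ≤ (1 - b / 4) ^ n * g₁ 1 := by
    intro n
    induction n with
    | zero => simp
    | succ n ih =>
      have h1 := hstep ((1 / 2) ^ n) (by positivity)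
      rw [pow_succ, mul_one_div, pow_succ]
      refine h1.trans ?_
      rw [mul_comm _ (1 - b / 4), mul_assoc]
      gcongr
  have hlarge : ∀ n : ℕ, g₁ 1 ≤ (1 - b / 4) ^ n * g₁ (2 ^ n) := by
    intro n
    induction n with
    | zero => simp
    | succ n ih =>
      have h1 := hstep (2 ^ (n + 1)) (by positivity)
      rw [pow_succ, mul_div_assoc, div_self two_ne_zero, mul_one] at h1
      refine ih.trans ?_
      rw [pow_succ (1 - b / 4), mul_assoc, pow_succ]
      gcongr
  have hg1 := h.deriv_pos one_pos
  have hlim := tendsto_pow_atTop_nhds_zero_of_lt_one hq.le (by linarith : 1 - b / 4 < 1)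
  obtain ⟨n, hn⟩ := ((tendsto_order.1 hlim).2 (N / g₁ 1) (by positivity)).exists
  obtain ⟨k, hk⟩ := ((tendsto_order.1 hlim).2 (g₁ 1 / N) (by positivity)).exists
  have hlo : g₁ ((1 / 2) ^ n) ≤ N := by
    refine (hsmall n).trans ?_
    rw [lt_div_iff₀ hg1] at hn
    exact hn.le
  have hhi : N ≤ g₁ (2 ^ k) := by
    have h1 := hlarge k
    rw [lt_div_iff₀ hN] at hk
    have : (1 - b / 4) ^ k * N ≤ (1 - b / 4) ^ k * g₁ (2 ^ k) := by linarith
    exact le_of_mul_le_mul_left this (by positivity)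
  have hcont : ContinuousOn g₁ (Set.Ioi 0) := fun t ht =>
    (h.hasDerivAt_deriv t ht).continuousAt.continuousWithinAt
  obtain ⟨c, hc, hc'⟩ := isPreconnected_Ioi.intermediate_value (s := Set.Ioi (0 : ℝ))
    (show (1 / 2 : ℝ) ^ n ∈ Set.Ioi 0 from Set.mem_Ioi.2 (by positivity))
    (show (2 : ℝ) ^ k ∈ Set.Ioi 0 from Set.mem_Ioi.2 (by positivity)) hcont ⟨hlo, hhi⟩
  exact ⟨c, hc, hc'⟩

lemma mul_le (h : IsGrowingCurve g g₁ g₂ b) {t : ℝ} (ht : 1 ≤ t) : t * g 1 ≤ g t := by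
  simpa using h.chord_le 1 t one_pos ht

lemma exists_eq_one (h : IsGrowingCurve g g₁ g₂ b) : ∃ c, 0 < c ∧ g c = 1 := by
  have h1 := h.pos 1 one_pos
  have hs0 : 0 < min 1 (1 / g 1) := lt_min one_pos (by positivity)
  have hlo : g (min 1 (1 / g 1)) ≤ 1 := by
    have := h.chord_le _ 1 hs0 (min_le_left _ _)
    rw [one_mul] at this
    refine this.trans ?_
    calc min 1 (1 / g 1) * g 1 ≤ 1 / g 1 * g 1 := by gcongr; exact min_le_right _ _
      _ = 1 := by field_simp
  have hhi : 1 ≤ g (max 1 (1 / g 1)) := by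
    refine le_trans ?_ (h.mul_le (le_max_left _ _))
    calc 1 = 1 / g 1 * g 1 := by field_simp
      _ ≤ _ := by gcongr; exact le_max_right _ _
  have hcont : ContinuousOn g (Set.Ioi 0) := fun t ht =>
    (h.hasDerivAt t ht).continuousAt.continuousWithinAt
  obtain ⟨c, hc, hc'⟩ := isPreconnected_Ioi.intermediate_value (s := Set.Ioi (0 : ℝ))
    (show _ ∈ Set.Ioi 0 from hs0)
    (show max 1 (1 / g 1) ∈ Set.Ioi 0 from
      Set.mem_Ioi.2 (zero_lt_one.trans_le (le_max_left _ _))) hcont ⟨hlo, hhi⟩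
  exact ⟨c, hc, hc'⟩

end IsGrowingCurve

lemma one_add_sq_rpow_le {a x y : ℝ} (ha' : a ≤ 1 / 4) (hx : 0 ≤ x) (hxy : x ≤ y)
    (hy : 1 ≤ y) : (1 + x ^ 2) ^ a ≤ 2 * √y := by
  have hs : √y ^ 4 = y ^ 2 := by
    rw [show 4 = 2 * 2 from rfl, pow_mul, Real.sq_sqrt (by linarith)]
  calc (1 + x ^ 2) ^ a ≤ (1 + x ^ 2) ^ (1 / 4 : ℝ) :=
        Real.rpow_le_rpow_of_exponent_le (by nlinarith) ha'
    _ ≤ ((2 * √y) ^ 4) ^ (1 / 4 : ℝ) := by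
        gcongr
        rw [mul_pow, hs]
        nlinarith
    _ = 2 * √y := by
        rw [← Real.rpow_natCast, ← Real.rpow_mul (by positivity)]
        norm_num

lemma one_add_sq_rpow_deriv_le {a x : ℝ} (ha' : a ≤ 1 / 4) (hx : 1 ≤ x) :
    a * (1 + x ^ 2) ^ (a - 1) * (2 * x) ≤ 1 / √x := by
  have h1 := one_add_sq_rpow_le ha' (by linarith) le_rfl hx
  have hx0 : 0 < x := by linarith
  have hs := Real.sq_sqrt hx0.le
  have hs0 := Real.sqrt_pos.2 hx0
  rw [Real.rpow_sub (by positivity), Real.rpow_one, le_div_iff₀ hs0]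
  have h2 : (1 + x ^ 2) ^ a / (1 + x ^ 2) ≤ 2 * √x / x ^ 2 := by
    gcongr
    linarith
  calc a * ((1 + x ^ 2) ^ a / (1 + x ^ 2)) * (2 * x) * √x
      ≤ 1 / 4 * (2 * √x / x ^ 2) * (2 * x) * √x := by gcongr
    _ = √x ^ 2 / x := by field_simp; ring
    _ = 1 := by rw [hs]; field_simp

namespace IsConvexCurve

variable {g g₁ g₂ : ℝ → ℝ}

/-- The estimate on an interval of length comparable to its distance from the origin. -/
lemma norm_integral_le_of_comparable (h : IsConvexCurve g g₁ g₂) {α β σ ξ c L M : ℝ} {z : ℂ}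
    (hc : 0 < c) (hα : c / 2 ≤ α) (hαβ : α ≤ β) (hβ : β ≤ 2 * c) (hσ : 1 ≤ |σ|) (hz : 0 < z.re)
    (hL : 0 < L) (hM : ∀ t ∈ Set.Icc α β, (1 + g t ^ 2) ^ z.re ≤ M)
    (hp : ∀ t ∈ Set.Icc α β, 1 ≤ L * |ξ + g₁ t|) :
    ‖∫ t in α..β, oscIntegrand σ ξ z g t‖ ≤ 12 * (2 + ‖z‖ / z.re) * L * M / c := by
  have hα0 : 0 < α := by linarith
  set D := 2 + ‖z‖ / z.re with hD
  have hD2 : 2 ≤ D := by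
    have : 0 ≤ ‖z‖ / z.re := by positivity
    linarith
  have ha := Set.left_mem_Icc.2 hαβ
  have hb := Set.right_mem_Icc.2 hαβ
  have hM0 : 0 ≤ M := le_trans (by positivity) (hM α ha)
  have hp0 : ∀ t ∈ Set.Icc α β, 0 < |ξ + g₁ t| := fun t ht =>
    pos_of_mul_pos_right (one_pos.trans_le (hp t ht)) hL.le
  have hinv : ∀ t ∈ Set.Icc α β, 1 / |ξ + g₁ t| ≤ L := fun t ht => by
    rw [div_le_iff₀ (hp0 t ht)]
    exact hp t ht
  have hti : ∀ t ∈ Set.Icc α β, 1 / t ≤ 2 / c := fun t ht => by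
    have := ht.1
    rw [div_le_div_iff₀ (by linarith) hc]
    linarith
  have key := h.norm_integral_le (σ := σ) (ξ := ξ) (z := z) hα0 hαβ hσ hz
    (fun t ht => abs_pos.1 (hp0 t ht))
    (Q := fun t => D * L * (2 / c * (1 + g t ^ 2) ^ z.re + 4 * M / c ^ 2 * t))
    (Q' := fun t => D * L * (2 / c * (z.re * (1 + g t ^ 2) ^ (z.re - 1) * (2 * g t * g₁ t)) +
      4 * M / c ^ 2 * 1))
    (fun t ht => by
      have h1 := hasDerivAt_one_add_sq_rpow z.re (h.hasDerivAt t (hα0.trans_le ht.1))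
      exact ((h1.const_mul _).add ((hasDerivAt_id' t).const_mul _)).const_mul _)
    (fun t ht => by
      have ht0 := hα0.trans_le ht.1
      have h0 := h.nonneg t ht0
      have h1 := h.deriv_nonneg t ht0
      have h2 := hM t ht
      have h3 := hinv t ht
      have h4 := hti t ht
      have h5 := hp0 t ht
      set B' := z.re * (1 + g t ^ 2) ^ (z.re - 1) * (2 * g t * g₁ t) with hB'
      have hB'0 : 0 ≤ B' := by positivity
      set B := (1 + g t ^ 2) ^ z.re with hB
      have hB0 : 0 ≤ B := by positivity
      change D * (B' / t + B / t ^ 2) / |ξ + g₁ t| ≤ _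
      calc D * (B' / t + B / t ^ 2) / |ξ + g₁ t|
          = D * (1 / |ξ + g₁ t|) * (1 / t * B' + B * (1 / t) ^ 2) := by field_simp
        _ ≤ D * L * (2 / c * B' + M * (2 / c) ^ 2) := by gcongr
        _ = _ := by field_simp; ring)
  have hbd : ∀ t ∈ Set.Icc α β, (1 + g t ^ 2) ^ z.re / (t * |ξ + g₁ t|) ≤ 2 * M * L / c := by
    intro t ht
    have ht0 := hα0.trans_le ht.1
    have h2 := hM t ht
    have h3 := hinv t ht
    have h4 := hti t ht
    have h5 := hp0 t ht
    calc (1 + g t ^ 2) ^ z.re / (t * |ξ + g₁ t|)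
        = (1 + g t ^ 2) ^ z.re * (1 / t) * (1 / |ξ + g₁ t|) := by field_simp
      _ ≤ M * (2 / c) * L := by gcongr
      _ = _ := by ring
  have h1 := hbd α ha
  have h2 := hbd β hb
  have hM1 := hM β hb
  have hB0 : 0 ≤ (1 + g α ^ 2) ^ z.re := by positivity
  have h3 : D * L * (2 / c * (1 + g β ^ 2) ^ z.re + 4 * M / c ^ 2 * β) -
      D * L * (2 / c * (1 + g α ^ 2) ^ z.re + 4 * M / c ^ 2 * α) ≤ 8 * D * L * M / c := by
    calc _ = D * L * (2 / c * ((1 + g β ^ 2) ^ z.re - (1 + g α ^ 2) ^ z.re) +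
          4 * M / c ^ 2 * (β - α)) := by ring
      _ ≤ D * L * (2 / c * M + 4 * M / c ^ 2 * (3 / 2 * c)) := by
        gcongr
        · linarith
        · linarith
      _ = _ := by field_simp; ring
  have h4 : 8 * (L * M / c) ≤ 4 * D * (L * M / c) := by
    gcongr
    linarith
  calc _ ≤ _ := key
    _ ≤ 2 * (2 * M * L / c) + 2 * (2 * M * L / c) + 8 * D * L * M / c := by gcongr
    _ = 8 * (L * M / c) + 8 * D * L * M / c := by ring
    _ ≤ 4 * D * (L * M / c) + 8 * D * L * M / c := by gcongr
    _ = _ := by ring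

end IsConvexCurve

/-- The estimate on an interval on which the derivative of the phase dominates that of `g`. -/
lemma IsGrowingCurve.norm_integral_tail_le {g g₁ g₂ : ℝ → ℝ} {b : ℝ}
    (h : IsGrowingCurve g g₁ g₂ b) {T R σ ξ K : ℝ} {z : ℂ} (hT : 0 < T) (hgT : 1 ≤ g T)
    (hTR : T ≤ R) (hσ : 1 ≤ |σ|) (hz : 0 < z.re) (hz' : z.re ≤ 1 / 4) (hK : 0 < K)
    (hp : ∀ t ∈ Set.Icc T R, g₁ t ≤ K * |ξ + g₁ t|) :
    ‖∫ t in T..R, oscIntegrand σ ξ z g t‖ ≤ 10 * (2 + ‖z‖ / z.re) * K / √(g T) := by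
  set D := 2 + ‖z‖ / z.re with hD
  have hD2 : 2 ≤ D := by
    have : 0 ≤ ‖z‖ / z.re := by positivity
    linarith
  have hpos : ∀ t ∈ Set.Icc T R, 0 < t := fun t ht => hT.trans_le ht.1
  have hp0 : ∀ t ∈ Set.Icc T R, 0 < |ξ + g₁ t| := fun t ht =>
    pos_of_mul_pos_right ((h.deriv_pos (hpos t ht)).trans_le (hp t ht)) hK.le
  have hg1 : ∀ t ∈ Set.Icc T R, 1 ≤ g t := fun t ht => hgT.trans (h.mono hT ht.1)
  have hinv : ∀ t ∈ Set.Icc T R, 1 / |ξ + g₁ t| ≤ K / g₁ t := fun t ht => by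
    rw [div_le_div_iff₀ (hp0 t ht) (h.deriv_pos (hpos t ht))]
    linarith [hp t ht]
  have hsT : 0 < √(g T) := Real.sqrt_pos.2 (by linarith)
  have hbase : ∀ t ∈ Set.Icc T R, (1 + g t ^ 2) ^ z.re / (t * g₁ t) ≤ 2 / √(g t) := by
    intro t ht
    have ht0 := hpos t ht
    have h1 := one_add_sq_rpow_le hz' (h.nonneg t ht0) le_rfl (hg1 t ht)
    have h2 := h.le_mul_deriv t ht0
    have h3 := h.pos t ht0
    have h4 := Real.sqrt_pos.2 h3
    calc (1 + g t ^ 2) ^ z.re / (t * g₁ t) ≤ 2 * √(g t) / g t := by gcongr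
      _ = 2 * √(g t) / (√(g t)) ^ 2 := by rw [Real.sq_sqrt h3.le]
      _ = _ := by field_simp
  have hdecay : ∀ t ∈ Set.Icc T R, 1 / √(g t) ≤ √T / √(g T) / √t := by
    intro t ht
    have ht0 := hpos t ht
    have h3 := Real.sqrt_pos.2 (h.pos t ht0)
    rw [div_div, div_le_div_iff₀ h3 (by positivity), one_mul,
      ← Real.sqrt_mul (h.nonneg T hT), ← Real.sqrt_mul hT.le]
    apply Real.sqrt_le_sqrt
    linarith [h.chord_le T t hT ht.1]
  have key := h.norm_integral_le (σ := σ) (ξ := ξ) (z := z) hT hTR hσ hz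
    (fun t ht => abs_pos.1 (hp0 t ht))
    (Q := fun t => -(6 * K * D * (√T / √(g T))) * (√t)⁻¹)
    (Q' := fun t => -(6 * K * D * (√T / √(g T))) * (-(1 / (2 * √t)) / (√t) ^ 2))
    (fun t ht => by
      have ht0 := hpos t ht
      exact ((Real.hasDerivAt_sqrt ht0.ne').inv (Real.sqrt_pos.2 ht0).ne').const_mul _)
    (fun t ht => by
      have ht0 := hpos t ht
      have h1 := one_add_sq_rpow_deriv_le hz' (hg1 t ht)
      have h2 := hbase t ht
      have h3 := hinv t ht
      have h4 := hdecay t ht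
      have h5 := hp0 t ht
      have h6 := h.deriv_pos ht0
      have h7 := h.pos t ht0
      have hst := Real.sqrt_pos.2 ht0
      set B := (1 + g t ^ 2) ^ z.re with hB
      set B₁ := z.re * (1 + g t ^ 2) ^ (z.re - 1) * (2 * g t) with hB₁
      have hB0 : 0 ≤ B := by positivity
      have hB₁0 : 0 ≤ B₁ := by positivity
      have hB' : z.re * (1 + g t ^ 2) ^ (z.re - 1) * (2 * g t * g₁ t) = B₁ * g₁ t := by
        rw [hB₁]; ring
      rw [hB']
      calc D * (B₁ * g₁ t / t + B / t ^ 2) / |ξ + g₁ t|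
          = D * (B₁ * g₁ t / t + B / t ^ 2) * (1 / |ξ + g₁ t|) := by ring
        _ ≤ D * (B₁ * g₁ t / t + B / t ^ 2) * (K / g₁ t) := by gcongr
        _ = D * K / t * (B₁ + B / (t * g₁ t)) := by field_simp
        _ ≤ D * K / t * (1 / √(g t) + 2 / √(g t)) := by gcongr
        _ = 3 * D * K / t * (1 / √(g t)) := by ring
        _ ≤ 3 * D * K / t * (√T / √(g T) / √t) := by gcongr
        _ = _ := by
          rw [Real.sq_sqrt ht0.le]
          field_simp
          ring)
  have hbd : ∀ t ∈ Set.Icc T R, (1 + g t ^ 2) ^ z.re / (t * |ξ + g₁ t|) ≤ 2 * K / √(g T) := by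
    intro t ht
    have ht0 := hpos t ht
    have h2 := hbase t ht
    have h3 := hinv t ht
    have h5 := hp0 t ht
    have h6 := h.deriv_pos ht0
    calc (1 + g t ^ 2) ^ z.re / (t * |ξ + g₁ t|)
        = (1 + g t ^ 2) ^ z.re / t * (1 / |ξ + g₁ t|) := by field_simp
      _ ≤ (1 + g t ^ 2) ^ z.re / t * (K / g₁ t) := by gcongr
      _ = K * ((1 + g t ^ 2) ^ z.re / (t * g₁ t)) := by field_simp
      _ ≤ K * (2 / √(g t)) := by gcongr
      _ ≤ K * (2 / √(g T)) := by
        have := h.mono hT ht.1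
        gcongr
      _ = _ := by ring
  have h1 := hbd T (Set.left_mem_Icc.2 hTR)
  have h2 := hbd R (Set.right_mem_Icc.2 hTR)
  have hsT' := Real.sqrt_pos.2 hT
  have h3 : -(6 * K * D * (√T / √(g T))) * (√R)⁻¹ - -(6 * K * D * (√T / √(g T))) * (√T)⁻¹ ≤
      6 * K * D / √(g T) := by
    have e1 : 0 ≤ 6 * K * D * (√T / √(g T)) * (√R)⁻¹ := by positivity
    have e2 : 6 * K * D * (√T / √(g T)) * (√T)⁻¹ = 6 * K * D / √(g T) := by field_simp
    linarith
  have h4 : 8 * (K / √(g T)) ≤ 4 * D * (K / √(g T)) := by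
    gcongr
    linarith
  calc _ ≤ _ := key
    _ ≤ 2 * (2 * K / √(g T)) + 2 * (2 * K / √(g T)) + 6 * K * D / √(g T) := by gcongr
    _ = 8 * (K / √(g T)) + 6 * K * D / √(g T) := by ring
    _ ≤ 4 * D * (K / √(g T)) + 6 * K * D / √(g T) := by gcongr
    _ = _ := by ring

lemma IsConvexCurve.intervalIntegrable_oscIntegrand {g g₁ g₂ : ℝ → ℝ} (h : IsConvexCurve g g₁ g₂)
    (σ ξ : ℝ) (z : ℂ) {s t : ℝ} (hs : 0 < s) (ht : 0 < t) :
    IntervalIntegrable (oscIntegrand σ ξ z g) volume s t :=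
  ((h.continuousOn_oscIntegrand σ ξ z).mono fun _ hx =>
    (lt_min hs ht).trans_le hx.1).intervalIntegrable

lemma norm_integral_max_le {f : ℝ → ℂ} {t₀ a b C : ℝ} (hab : a ≤ b) (hC : 0 ≤ C)
    (h : t₀ < b → ‖∫ t in (max t₀ a)..b, f t‖ ≤ C) :
    ‖∫ t in (max t₀ a)..(max t₀ b), f t‖ ≤ C := by
  rcases le_or_gt b t₀ with hb | hb
  · rw [max_eq_left hb, max_eq_left (hab.trans hb)]
    simpa using hC
  · rw [max_eq_right hb.le]
    exact h hb

/-- Up to the point from which on the derivative of the phase dominates that of `g`, the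
oscillatory integral is bounded. -/
lemma IsGrowingCurve.exists_norm_integral_le {g g₁ g₂ : ℝ → ℝ} {b : ℝ}
    (h : IsGrowingCurve g g₁ g₂ b) {t₀ : ℝ} (ht₀ : 0 < t₀) (hgt₀ : g t₀ = 1) {z : ℂ}
    (hz : 0 < z.re) (hz' : z.re ≤ 1 / 4) (ξ : ℝ) :
    ∃ T, t₀ ≤ T ∧ (∀ t, T ≤ t → g₁ t ≤ 4 / b * |ξ + g₁ t|) ∧ ∀ σ : ℝ, 1 ≤ |σ| →
      ‖∫ t in t₀..T, oscIntegrand σ ξ z g t‖ ≤ 1600 * (2 + ‖z‖ / z.re) / b := by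
  have hb := h.rate_pos
  have hb1 := h.rate_le_one
  have hK : 4 ≤ 4 / b := by
    rw [le_div_iff₀ hb]
    linarith
  set D := 2 + ‖z‖ / z.re with hD
  have hD2 : 2 ≤ D := by
    have : 0 ≤ ‖z‖ / z.re := by positivity
    linarith
  have hC0 : 0 ≤ 1600 * D / b := by positivity
  rcases le_or_gt 0 ξ with hξ | hξ
  · refine ⟨t₀, le_rfl, fun t ht => ?_, fun σ hσ => by simpa using hC0⟩
    have h1 := h.deriv_pos (ht₀.trans_le ht)
    rw [abs_of_nonneg (by linarith)]
    nlinarith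
  obtain ⟨N, rfl⟩ : ∃ N, ξ = -N := ⟨-ξ, by ring⟩
  have hN : 0 < N := by linarith
  obtain ⟨c, hc, hcN⟩ := h.exists_deriv_eq hN
  obtain ⟨d, hd, hdN⟩ := h.exists_deriv_eq (by positivity : 0 < 2 * N)
  have hcd : c ≤ d := by
    by_contra! hlt
    have := h.deriv_mono hd hlt.le
    linarith
  set e := min (2 * c) d with he
  have hce : c ≤ e := le_min (by linarith) hcd
  have he2c : e ≤ 2 * c := min_le_left _ _
  have he0 : 0 < e := hc.trans_le hce
  have heN : g₁ e ≤ 2 * N := by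
    rw [← hdN]
    exact h.deriv_mono he0 (min_le_right _ _)
  have htail : ∀ t, e ≤ t → g₁ t ≤ 4 / b * |-N + g₁ t| := by
    intro t ht
    have ht0 := he0.trans_le ht
    have h1 := h.deriv_pos ht0
    rw [div_mul_eq_mul_div, le_div_iff₀ hb]
    have h2 := le_abs_self (-N + g₁ t)
    rcases min_le_iff.1 ht with h3 | h3
    · have h4 := h.gap hc (by linarith : c ≤ t)
      rw [hcN] at h4
      have h5 : t * (b / 4 * g₁ t) ≤ t * (g₁ t - N) := by
        refine le_trans ?_ h4
        have : b / 2 * (t / 2) * g₁ t ≤ b / 2 * (t - c) * g₁ t := by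
          gcongr
          linarith
        linarith
      have := le_of_mul_le_mul_left h5 ht0
      linarith
    · have := h.deriv_mono hd h3
      nlinarith
  rcases le_or_gt e t₀ with het | het
  · exact ⟨t₀, le_rfl, fun t ht => htail t (het.trans ht), fun σ hσ => by simpa using hC0⟩
  refine ⟨e, het.le, htail, fun σ hσ => ?_⟩
  set Y := 4 * c * N with hY
  have hgY : ∀ t, 0 < t → t ≤ e → g t ≤ Y := by
    intro t ht hte
    calc g t ≤ g e := h.mono ht hte
      _ ≤ e * g₁ e := h.le_mul_deriv e he0
      _ ≤ 2 * c * (2 * N) := by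
        have := h.deriv_nonneg e he0
        gcongr
      _ = Y := by ring
  have hY1 : 1 ≤ Y := hgt₀ ▸ hgY t₀ ht₀ het.le
  set S := √Y with hS
  have hS1 : 1 ≤ S := Real.one_le_sqrt.2 hY1
  have hSY : S ^ 2 = Y := Real.sq_sqrt (by linarith)
  have hS0 : 0 < S := by linarith
  have hM : ∀ t, 0 < t → t ≤ e → (1 + g t ^ 2) ^ z.re ≤ 2 * S := fun t ht hte =>
    one_add_sq_rpow_le hz' (h.nonneg t ht) (hgY t ht hte) hY1
  set ρ := c / (2 * S) with hρ
  have hρ0 : 0 < ρ := by positivity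
  have hρc : ρ ≤ c / 2 := by
    rw [hρ]
    gcongr
    linarith
  set L := 32 * c / (b * S) with hL
  have hL0 : 0 < L := by positivity
  have hLN : L * (b / 2 * ρ * N) = 2 * c := by
    have : N = S ^ 2 / (4 * c) := by rw [hSY, hY]; field_simp
    rw [this, hL, hρ]
    field_simp
    norm_num
  have hInt : ∀ s t, 0 < s → 0 < t → IntervalIntegrable (oscIntegrand σ (-N) z g) volume s t :=
    fun s t hs ht => h.intervalIntegrable_oscIntegrand σ (-N) z hs ht
  have hX : ∀ a, 0 < max t₀ a := fun a => ht₀.trans_le (le_max_left _ _)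
  have hC1 : 0 ≤ 768 * D / b := by positivity
  have hC2 : 0 ≤ 40 * D / b := by positivity
  have i1 : ‖∫ t in (max t₀ 0)..(max t₀ (c / 2)), oscIntegrand σ (-N) z g t‖ ≤ 40 * D / b := by
    refine norm_integral_max_le (by positivity) hC2 fun hlt => ?_
    rw [max_eq_left ht₀.le]
    refine (h.norm_integral_tail_le ht₀ hgt₀.ge hlt.le hσ hz hz'
      (by positivity : 0 < 4 / b) fun t ht => ?_).trans_eq ?_
    · have ht0 := ht₀.trans_le ht.1
      have h1 := h.gap ht0 (by linarith [ht.2] : t ≤ c)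
      rw [hcN] at h1
      have h2 : g₁ t ≤ N := hcN ▸ h.deriv_mono ht0 (by linarith [ht.2])
      rw [div_mul_eq_mul_div, le_div_iff₀ hb, abs_of_nonpos (by linarith)]
      have h3 : c * (b / 4 * N) ≤ c * (N - g₁ t) := by
        refine le_trans ?_ h1
        have : b / 2 * (c / 2) * N ≤ b / 2 * (c - t) * N := by
          gcongr
          linarith [ht.2]
        linarith
      have h4 := le_of_mul_le_mul_left h3 hc
      nlinarith
    · rw [hgt₀, Real.sqrt_one, ← hD]
      ring
  have i2 : ‖∫ t in (max t₀ (c / 2))..(max t₀ (c - ρ)), oscIntegrand σ (-N) z g t‖ ≤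
      768 * D / b := by
    refine norm_integral_max_le (by linarith) hC1 fun hlt => ?_
    refine (h.norm_integral_le_of_comparable hc (le_max_right _ _)
      (max_le hlt.le (by linarith)) (by linarith) hσ hz hL0
      (fun t ht => hM t ((hX _).trans_le ht.1) (by linarith [ht.2])) fun t ht => ?_).trans_eq ?_
    · have ht0 := (hX _).trans_le ht.1
      have h1 := h.gap ht0 (by linarith [ht.2] : t ≤ c)
      rw [hcN] at h1
      have h2 : g₁ t ≤ N := hcN ▸ h.deriv_mono ht0 (by linarith [ht.2])
      rw [abs_of_nonpos (by linarith)]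
      have h3 : b / 2 * ρ * N ≤ c * (N - g₁ t) := by
        refine le_trans ?_ h1
        gcongr
        linarith [ht.2]
      have h4 : L * (b / 2 * ρ * N) ≤ L * (c * (N - g₁ t)) := by gcongr
      rw [hLN] at h4
      have h5 : c * 1 ≤ c * (L * -(-N + g₁ t)) := by linarith
      exact le_of_mul_le_mul_left h5 hc
    · rw [hL, ← hD]
      field_simp
      norm_num
  have hm1 : c - ρ ≤ min (c + ρ) e := le_min (by linarith) (by linarith)
  have i3 : ‖∫ t in (max t₀ (c - ρ))..(max t₀ (min (c + ρ) e)), oscIntegrand σ (-N) z g t‖ ≤ 4 := by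
    refine norm_integral_max_le hm1 (by norm_num) fun hlt => ?_
    have hle : max t₀ (c - ρ) ≤ min (c + ρ) e := max_le hlt.le hm1
    refine (intervalIntegral.norm_integral_le_of_norm_le_const (C := 4 * S / c)
      fun t ht => ?_).trans ?_
    · rw [Set.uIoc_of_le hle] at ht
      have ht0 := (hX _).trans ht.1
      rw [norm_oscIntegrand _ _ _ _ ht0]
      have h1 := hM t ht0 (ht.2.trans (min_le_right _ _))
      have h2 : c / 2 ≤ t := by
        have := (le_max_right t₀ (c - ρ)).trans ht.1.le
        linarith
      calc (1 + g t ^ 2) ^ z.re / t ≤ 2 * S / (c / 2) := by gcongr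
        _ = 4 * S / c := by field_simp; norm_num
    · rw [abs_of_nonneg (by linarith)]
      have h1 : min (c + ρ) e - max t₀ (c - ρ) ≤ 2 * ρ := by
        have := le_max_right t₀ (c - ρ)
        have := min_le_left (c + ρ) e
        linarith
      calc 4 * S / c * (min (c + ρ) e - max t₀ (c - ρ)) ≤ 4 * S / c * (2 * ρ) := by gcongr
        _ = 4 := by rw [hρ]; field_simp
  have i4 : ‖∫ t in (max t₀ (min (c + ρ) e))..(max t₀ e), oscIntegrand σ (-N) z g t‖ ≤
      768 * D / b := by
    refine norm_integral_max_le (min_le_right _ _) hC1 fun hlt => ?_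
    rcases le_or_gt e (c + ρ) with h0 | h0
    · rw [min_eq_right h0, max_eq_right hlt.le]
      simpa using hC1
    rw [min_eq_left h0.le]
    refine (h.norm_integral_le_of_comparable hc (le_trans (by linarith) (le_max_right _ _))
      (max_le hlt.le h0.le) he2c hσ hz hL0
      (fun t ht => hM t ((hX _).trans_le ht.1) ht.2) fun t ht => ?_).trans_eq ?_
    · have ht0 := (hX _).trans_le ht.1
      have htc : c + ρ ≤ t := (le_max_right _ _).trans ht.1
      have h1 := h.gap hc (by linarith : c ≤ t)
      rw [hcN] at h1
      have h2 : N ≤ g₁ t := hcN ▸ h.deriv_mono hc (by linarith)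
      rw [abs_of_nonneg (by linarith)]
      have h3 : b / 2 * ρ * N ≤ 2 * c * (g₁ t - N) := by
        calc b / 2 * ρ * N ≤ b / 2 * (t - c) * N := by
              gcongr
              linarith
          _ ≤ b / 2 * (t - c) * g₁ t := by
              have : 0 ≤ b / 2 * (t - c) := mul_nonneg (by positivity) (by linarith)
              gcongr
          _ ≤ t * (g₁ t - N) := h1
          _ ≤ 2 * c * (g₁ t - N) := by
              have := ht.2
              gcongr
              linarith
      have h4 : L * (b / 2 * ρ * N) ≤ L * (2 * c * (g₁ t - N)) := by gcongr
      rw [hLN] at h4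
      have h5 : 2 * c * 1 ≤ 2 * c * (L * (-N + g₁ t)) := by linarith
      exact le_of_mul_le_mul_left h5 (by positivity)
    · rw [hL, ← hD]
      field_simp
      norm_num
  have hsplit : ∫ t in t₀..e, oscIntegrand σ (-N) z g t =
      (∫ t in (max t₀ 0)..(max t₀ (c / 2)), oscIntegrand σ (-N) z g t) +
      (∫ t in (max t₀ (c / 2))..(max t₀ (c - ρ)), oscIntegrand σ (-N) z g t) +
      (∫ t in (max t₀ (c - ρ))..(max t₀ (min (c + ρ) e)), oscIntegrand σ (-N) z g t) +
      ∫ t in (max t₀ (min (c + ρ) e))..(max t₀ e), oscIntegrand σ (-N) z g t := by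
    rw [intervalIntegral.integral_add_adjacent_intervals (hInt _ _ (hX _) (hX _))
        (hInt _ _ (hX _) (hX _)),
      intervalIntegral.integral_add_adjacent_intervals (hInt _ _ (hX _) (hX _))
        (hInt _ _ (hX _) (hX _)),
      intervalIntegral.integral_add_adjacent_intervals (hInt _ _ (hX _) (hX _))
        (hInt _ _ (hX _) (hX _)), max_eq_left ht₀.le, max_eq_right het.le]
  rw [hsplit]
  have hDb : 2 ≤ D / b := by
    rw [le_div_iff₀ hb]
    nlinarith
  have e1 : 40 * D / b = 40 * (D / b) := by ring
  have e2 : 768 * D / b = 768 * (D / b) := by ring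
  have e3 : 1600 * D / b = 1600 * (D / b) := by ring
  refine (norm_add₄_le).trans ?_
  linarith

/-- The linear phase: integration by parts. -/
lemma norm_integral_oscIntegrand_zero_le {α β σ ξ : ℝ} {z : ℂ} (hα : 0 < α) (hαβ : α ≤ β)
    (hσ : 1 ≤ |σ|) (hz : 0 < z.re) (hξ : ξ ≠ 0) :
    ‖∫ t in α..β, oscIntegrand σ ξ z 0 t‖ ≤ (4 + (2 + ‖z‖ / z.re)) / (α * |ξ|) := by
  have hξ' : 0 < |ξ| := abs_pos.2 hξ
  have hβ := hα.trans_le hαβ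
  set D := 2 + ‖z‖ / z.re with hD
  have hD0 : 0 ≤ D := by positivity
  have key := isConvexCurve_zero.norm_integral_le (σ := σ) (ξ := ξ) (z := z) hα hαβ hσ hz
    (fun t ht => by simpa using hξ) (Q := fun t => -(D / |ξ|) * t⁻¹)
    (Q' := fun t => -(D / |ξ|) * -(t ^ 2)⁻¹)
    (fun t ht => (hasDerivAt_inv (hα.trans_le ht.1).ne').const_mul _)
    (fun t ht => by
      have := (hα.trans_le ht.1).ne'
      apply le_of_eq
      simp [← hD]
      field_simp)
  simp only [Pi.zero_apply, add_zero, ne_eq, OfNat.ofNat_ne_zero, not_false_eq_true, zero_pow,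
    Real.one_rpow] at key
  refine key.trans ?_
  have h1 : 1 / (β * |ξ|) ≤ 1 / (α * |ξ|) := by gcongr
  have h2 : 0 ≤ D / |ξ| * β⁻¹ := by positivity
  have h3 : D / |ξ| * α⁻¹ = D * (1 / (α * |ξ|)) := by field_simp
  have h4 : (4 + D) / (α * |ξ|) = 4 * (1 / (α * |ξ|)) + D * (1 / (α * |ξ|)) := by ring
  linarith

/-- A criterion for the existence of the improper integral `∫_0^∞ f`. -/
lemma exists_tendsto_integral_inv {f : ℝ → ℂ} (hf : ContinuousOn f (Set.Ioi 0))
    {t₀ T K M₁ M₂ : ℝ} (ht₀ : 0 < t₀) (hK : ∀ t, 0 < t → t ≤ t₀ → ‖f t‖ ≤ K)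
    (hM₁ : ∀ r, 0 < r → r ≤ t₀ → ‖∫ t in r..t₀, f t‖ ≤ M₁)
    (hM₂ : ∀ R, T ≤ R → ‖∫ t in t₀..R, f t‖ ≤ M₂)
    (hdecay : ∀ ε, 0 < ε → ∃ S, 0 < S ∧ ∀ R, S ≤ R → ‖∫ t in S..R, f t‖ ≤ ε) :
    ∃ m, Tendsto (fun r : ℝ => ∫ t in r..r⁻¹, f t) (𝓝[>] 0) (𝓝 m) ∧ ‖m‖ ≤ M₁ + M₂ := by
  have hInt : ∀ s t, 0 < s → 0 < t → IntervalIntegrable f volume s t := fun s t hs ht =>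
    (hf.mono fun _ hx => (lt_min hs ht).trans_le hx.1).intervalIntegrable
  have hInt₀ : IntervalIntegrable f volume t₀ 0 := by
    rw [intervalIntegrable_iff, Set.uIoc_of_ge ht₀.le]
    refine IntegrableOn.of_bound (by simp)
      ((hf.mono Set.Ioc_subset_Ioi_self).aestronglyMeasurable measurableSet_Ioc) K ?_
    filter_upwards [ae_restrict_mem measurableSet_Ioc] with t ht using hK t ht.1 ht.2
  have h0 : Tendsto (fun r => ∫ t in r..t₀, f t) (𝓝[>] 0) (𝓝 (∫ t in (0 : ℝ)..t₀, f t)) := by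
    have h1 := intervalIntegral.continuousOn_primitive_interval' hInt₀ Set.left_mem_uIcc
    have h2 := (h1 0 Set.right_mem_uIcc).tendsto
    rw [Set.uIcc_of_ge ht₀.le] at h2
    have h3 : 𝓝[>] (0 : ℝ) ≤ 𝓝[Set.Icc 0 t₀] 0 := by
      rw [← nhdsWithin_Ioc_eq_nhdsGT ht₀]
      exact nhdsWithin_mono _ Set.Ioc_subset_Icc_self
    have h4 := (h2.mono_left h3).neg
    simpa only [← intervalIntegral.integral_symm] using h4
  obtain ⟨m, hm⟩ : ∃ m, Tendsto (fun R => ∫ t in t₀..R, f t) atTop (𝓝 m) := by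
    refine cauchySeq_tendsto_of_complete (Metric.cauchySeq_iff'.2 fun ε hε => ?_)
    obtain ⟨S, hS, hS'⟩ := hdecay (ε / 2) (half_pos hε)
    refine ⟨S, fun R hR => ?_⟩
    rw [dist_eq_norm, intervalIntegral.integral_interval_sub_left
      (hInt _ _ ht₀ (hS.trans_le hR)) (hInt _ _ ht₀ hS)]
    exact (hS' R hR).trans_lt (half_lt_self hε)
  refine ⟨(∫ t in (0 : ℝ)..t₀, f t) + m, ?_, ?_⟩
  · refine (h0.add (hm.comp tendsto_inv_nhdsGT_zero)).congr' ?_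
    filter_upwards [self_mem_nhdsWithin] with r hr
    exact intervalIntegral.integral_add_adjacent_intervals (hInt _ _ hr ht₀)
      (hInt _ _ ht₀ (inv_pos.2 hr))
  · refine (norm_add_le _ _).trans (add_le_add ?_ ?_)
    · refine le_of_tendsto h0.norm ?_
      filter_upwards [Ioc_mem_nhdsGT ht₀] with r hr using hM₁ r hr.1 hr.2
    · refine le_of_tendsto hm.norm ?_
      filter_upwards [eventually_ge_atTop T] with R hR using hM₂ R hR

lemma norm_exp_mul_I_sub_le (x y : ℝ) :
    ‖Complex.exp ((x : ℂ) * Complex.I) - Complex.exp ((y : ℂ) * Complex.I)‖ ≤ |x - y| := by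
  have h : Complex.exp ((x : ℂ) * Complex.I) - Complex.exp ((y : ℂ) * Complex.I) =
      Complex.exp ((y : ℂ) * Complex.I) * (Complex.exp (Complex.I * ((x - y : ℝ) : ℂ)) - 1) := by
    rw [mul_sub, ← Complex.exp_add, mul_one]
    congr 2
    push_cast
    ring
  rw [h, norm_mul, Complex.norm_exp_ofReal_mul_I, one_mul]
  exact Real.norm_exp_I_mul_ofReal_sub_one_le

lemma amplitude_zero (z : ℂ) : amplitude z 0 = 1 := by simp [amplitude]

lemma norm_amplitude_sub_one_le {z : ℂ} (hz : z.re ≤ 1) {x : ℝ} (hx : 0 ≤ x) (hx' : x ≤ 1) :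
    ‖amplitude z x - 1‖ ≤ 2 * ‖z‖ * x := by
  have key := Convex.norm_image_sub_le_of_norm_hasDerivWithin_le (C := 2 * ‖z‖)
    (s := Set.Icc (0 : ℝ) 1) (x := 0) (y := x)
    (fun y _ => (hasDerivAt_amplitude_comp z (hasDerivAt_id' y)).hasDerivWithinAt)
    (fun y hy => by
      rw [norm_mul, norm_mul, norm_amplitude, Complex.norm_real, Complex.sub_re, Complex.one_re,
        mul_one, Real.norm_of_nonneg (mul_nonneg zero_le_two hy.1)]
      have h1 : (1 + y ^ 2) ^ (z.re - 1) ≤ 1 :=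
        Real.rpow_le_one_of_one_le_of_nonpos (by nlinarith [sq_nonneg y]) (by linarith)
      have h2 := hy.1
      calc ‖z‖ * (1 + y ^ 2) ^ (z.re - 1) * (2 * y) ≤ ‖z‖ * 1 * (2 * 1) := by
            gcongr
            exact hy.2
        _ = 2 * ‖z‖ := by ring)
    (convex_Icc 0 1) (by simp) ⟨hx, hx'⟩
  rwa [amplitude_zero, sub_zero, Real.norm_of_nonneg hx] at key

lemma norm_oscIntegrand_sub_le {σ ξ : ℝ} {z : ℂ} (hz : z.re ≤ 1) {g : ℝ → ℝ} {t : ℝ} (ht : 0 < t)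
    (hg : 0 ≤ g t) (hg' : g t ≤ 1) :
    ‖oscIntegrand σ ξ z g t - oscIntegrand σ ξ z 0 t‖ ≤ (2 * ‖z‖ + |σ|) * (g t / t) := by
  simp only [oscIntegrand, Pi.zero_apply, amplitude_zero, mul_one, add_zero]
  rw [← sub_div, norm_div, Complex.norm_real, Real.norm_of_nonneg ht.le, ← mul_div_assoc]
  gcongr
  set u := Complex.exp (((σ * (ξ * t + g t) : ℝ) : ℂ) * Complex.I) with hu
  set v := Complex.exp (((σ * (ξ * t) : ℝ) : ℂ) * Complex.I) with hv
  have h1 : u * amplitude z (g t) - v = u * (amplitude z (g t) - 1) + (u - v) := by ring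
  have h2 := norm_exp_mul_I_sub_le (σ * (ξ * t + g t)) (σ * (ξ * t))
  rw [← mul_sub, add_sub_cancel_left, abs_mul, abs_of_nonneg hg] at h2
  have h3 := norm_amplitude_sub_one_le hz hg hg'
  rw [h1]
  refine (norm_add_le _ _).trans ?_
  rw [norm_mul, hu, Complex.norm_exp_ofReal_mul_I, one_mul]
  linarith

/-- The integrand `-2 i sin(s(ξt + g(t))) (1 + g(t)²)^z / t`. -/
noncomputable def sinIntegrand (s ξ : ℝ) (z : ℂ) (g : ℝ → ℝ) (t : ℝ) : ℂ :=
  oscIntegrand (-s) ξ z g t - oscIntegrand s ξ z g t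

lemma IsConvexCurve.continuousOn_sinIntegrand {g g₁ g₂ : ℝ → ℝ} (h : IsConvexCurve g g₁ g₂)
    (s ξ : ℝ) (z : ℂ) : ContinuousOn (sinIntegrand s ξ z g) (Set.Ioi 0) :=
  (h.continuousOn_oscIntegrand _ _ _).sub (h.continuousOn_oscIntegrand _ _ _)

lemma IsConvexCurve.intervalIntegrable_sinIntegrand {g g₁ g₂ : ℝ → ℝ} (h : IsConvexCurve g g₁ g₂)
    (s ξ : ℝ) (z : ℂ) {a b : ℝ} (ha : 0 < a) (hb : 0 < b) :
    IntervalIntegrable (sinIntegrand s ξ z g) volume a b :=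
  (h.intervalIntegrable_oscIntegrand _ _ _ ha hb).sub (h.intervalIntegrable_oscIntegrand _ _ _ ha hb)

lemma IsConvexCurve.norm_integral_sinIntegrand_le {g g₁ g₂ : ℝ → ℝ} (h : IsConvexCurve g g₁ g₂)
    {s ξ a b C : ℝ} {z : ℂ} (ha : 0 < a) (hb : 0 < b) (hs : 1 ≤ s)
    (hC : ∀ σ : ℝ, 1 ≤ |σ| → ‖∫ t in a..b, oscIntegrand σ ξ z g t‖ ≤ C) :
    ‖∫ t in a..b, sinIntegrand s ξ z g t‖ ≤ 2 * C := by
  unfold sinIntegrand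
  rw [intervalIntegral.integral_sub (h.intervalIntegrable_oscIntegrand _ _ _ ha hb)
    (h.intervalIntegrable_oscIntegrand _ _ _ ha hb), two_mul]
  have h1 : 1 ≤ |s| := hs.trans (le_abs_self s)
  exact (norm_sub_le _ _).trans (add_le_add (hC _ (by rwa [abs_neg])) (hC _ h1))

lemma norm_sinIntegrand_zero_le {s ξ t : ℝ} (z : ℂ) (hs : 0 ≤ s) (ht : 0 < t) :
    ‖sinIntegrand s ξ z 0 t‖ ≤ 2 * s * |ξ| := by
  simp only [sinIntegrand, oscIntegrand, Pi.zero_apply, amplitude_zero, mul_one, add_zero]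
  rw [← sub_div, norm_div, Complex.norm_real, Real.norm_of_nonneg ht.le, div_le_iff₀ ht]
  refine (norm_exp_mul_I_sub_le _ _).trans_eq ?_
  rw [show -s * (ξ * t) - s * (ξ * t) = -(2 * s * ξ * t) by ring, abs_neg, abs_mul, abs_mul,
    abs_of_pos ht, abs_of_nonneg (by positivity : 0 ≤ 2 * s)]

lemma norm_integral_sinIntegrand_zero_le {s ξ a b : ℝ} {z : ℂ} (hs : 1 ≤ s) (hz : 0 < z.re)
    (ha : 0 < a) (hab : a ≤ b) :
    ‖∫ t in a..b, sinIntegrand s ξ z 0 t‖ ≤ 2 * s + 2 * (4 + (2 + ‖z‖ / z.re)) := by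
  set D := 4 + (2 + ‖z‖ / z.re) with hD
  have hD0 : 0 ≤ D := by positivity
  have hb := ha.trans_le hab
  have hsmall : ∀ c, a ≤ c → c * |ξ| ≤ 1 → ‖∫ t in a..c, sinIntegrand s ξ z 0 t‖ ≤ 2 * s := by
    intro c hac hc
    refine (intervalIntegral.norm_integral_le_of_norm_le_const (C := 2 * s * |ξ|)
      fun t ht => ?_).trans ?_
    · rw [Set.uIoc_of_le hac] at ht
      exact norm_sinIntegrand_zero_le z (by linarith) (ha.trans ht.1)
    · rw [abs_of_nonneg (by linarith : 0 ≤ c - a)]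
      have : |ξ| * (c - a) ≤ 1 := by nlinarith [abs_nonneg ξ]
      nlinarith
  have hlarge : ∀ c, 0 < c → c ≤ b → 1 ≤ c * |ξ| →
      ‖∫ t in c..b, sinIntegrand s ξ z 0 t‖ ≤ 2 * D := by
    intro c hc hcb h1
    refine isConvexCurve_zero.norm_integral_sinIntegrand_le hc hb hs fun σ hσ => ?_
    have hξ : ξ ≠ 0 := by
      rintro rfl
      norm_num at h1
    exact (norm_integral_oscIntegrand_zero_le hc hcb hσ hz hξ).trans (div_le_self hD0 h1)
  rcases le_total (b * |ξ|) 1 with h1 | h1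
  · linarith [hsmall b hab h1]
  rcases le_total 1 (a * |ξ|) with h2 | h2
  · linarith [hlarge a ha hab h2]
  have hξ : 0 < |ξ| := pos_of_mul_pos_right (one_pos.trans_le h1) hb.le
  have hc : 0 < 1 / |ξ| := by positivity
  have hc1 : 1 / |ξ| * |ξ| = 1 := by field_simp
  rw [← intervalIntegral.integral_add_adjacent_intervals
    (isConvexCurve_zero.intervalIntegrable_sinIntegrand s ξ z ha hc)
    (isConvexCurve_zero.intervalIntegrable_sinIntegrand s ξ z hc hb)]
  refine (norm_add_le _ _).trans (add_le_add ?_ ?_)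
  · exact hsmall _ (by rwa [le_div_iff₀ hξ]) hc1.le
  · exact hlarge _ hc (by rwa [div_le_iff₀ hξ]) hc1.ge

lemma exists_tendsto_integral_sinIntegrand_zero {s : ℝ} (ξ : ℝ) {z : ℂ} (hs : 1 ≤ s)
    (hz : 0 < z.re) :
    ∃ m, Tendsto (fun r : ℝ => ∫ t in r..r⁻¹, sinIntegrand s ξ z 0 t) (𝓝[>] 0) (𝓝 m) ∧
      ‖m‖ ≤ (2 * s + 2 * (4 + (2 + ‖z‖ / z.re))) + (2 * s + 2 * (4 + (2 + ‖z‖ / z.re))) := by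
  set D := 4 + (2 + ‖z‖ / z.re) with hD
  have hD0 : 0 < D := by positivity
  refine exists_tendsto_integral_inv (T := 1) (isConvexCurve_zero.continuousOn_sinIntegrand s ξ z)
    one_pos (fun t ht _ => norm_sinIntegrand_zero_le z (by linarith) ht)
    (fun r hr hr1 => norm_integral_sinIntegrand_zero_le hs hz hr hr1)
    (fun R hR => norm_integral_sinIntegrand_zero_le hs hz one_pos hR) fun ε hε => ?_
  rcases eq_or_ne ξ 0 with rfl | hξ
  · refine ⟨1, one_pos, fun R _ => ?_⟩
    have h1 : sinIntegrand s 0 z 0 = 0 := by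
      ext t
      simp [sinIntegrand, oscIntegrand]
    simpa [h1] using hε.le
  · have hξ' := abs_pos.2 hξ
    have hS : 0 < 2 * D / (ε * |ξ|) := by positivity
    refine ⟨2 * D / (ε * |ξ|), hS, fun R hR => ?_⟩
    refine (isConvexCurve_zero.norm_integral_sinIntegrand_le hS (hS.trans_le hR) hs fun σ hσ =>
      norm_integral_oscIntegrand_zero_le hS hR hσ hz hξ).trans_eq ?_
    rw [← hD]
    field_simp

lemma IsGrowingCurve.exists_tendsto_integral_sinIntegrand {g g₁ g₂ : ℝ → ℝ} {b : ℝ}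
    (h : IsGrowingCurve g g₁ g₂ b) {s : ℝ} (ξ : ℝ) {z : ℂ} (hs : 1 ≤ s) (hz : 0 < z.re)
    (hz' : z.re ≤ 1 / 4) :
    ∃ m, Tendsto (fun r : ℝ => ∫ t in r..r⁻¹, sinIntegrand s ξ z g t) (𝓝[>] 0) (𝓝 m) ∧
      ‖m‖ ≤ (2 * s + 2 * (4 + (2 + ‖z‖ / z.re)) + 2 * (2 * ‖z‖ + s)) +
        2 * (1640 * (2 + ‖z‖ / z.re) / b) := by
  obtain ⟨t₀, ht₀, hgt₀⟩ := h.exists_eq_one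
  obtain ⟨T, hT, hdom, hbound⟩ := h.exists_norm_integral_le ht₀ hgt₀ hz hz' ξ
  have hb := h.rate_pos
  have hT0 := ht₀.trans_le hT
  set D := 2 + ‖z‖ / z.re with hD
  have hD0 : 0 < D := by positivity
  have hK : 0 < 4 / b := by positivity
  have hdiff : ∀ t, 0 < t → t ≤ t₀ →
      ‖sinIntegrand s ξ z g t - sinIntegrand s ξ z 0 t‖ ≤ 2 * (2 * ‖z‖ + s) / t₀ := by
    intro t ht htt
    have h1 : g t / t ≤ 1 / t₀ := by
      have := h.chord_le t t₀ ht htt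
      rw [div_le_div_iff₀ ht ht₀]
      rw [hgt₀] at this
      linarith
    have h2 : g t ≤ 1 := hgt₀ ▸ h.mono ht htt
    have h3 : ∀ σ : ℝ, |σ| = s → ‖oscIntegrand σ ξ z g t - oscIntegrand σ ξ z 0 t‖ ≤
        (2 * ‖z‖ + s) * (1 / t₀) := by
      intro σ hσ
      refine (norm_oscIntegrand_sub_le (by linarith) ht (h.nonneg t ht) h2).trans ?_
      rw [hσ]
      gcongr
    have hs' : |s| = s := abs_of_nonneg (by linarith)
    have h4 : sinIntegrand s ξ z g t - sinIntegrand s ξ z 0 t =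
        (oscIntegrand (-s) ξ z g t - oscIntegrand (-s) ξ z 0 t) -
          (oscIntegrand s ξ z g t - oscIntegrand s ξ z 0 t) := by
      simp only [sinIntegrand]
      ring
    rw [h4]
    refine (norm_sub_le _ _).trans ((add_le_add (h3 _ (by rwa [abs_neg])) (h3 _ hs')).trans_eq ?_)
    ring
  refine exists_tendsto_integral_inv (T := T) (K := 2 * s * |ξ| + 2 * (2 * ‖z‖ + s) / t₀)
    (h.continuousOn_sinIntegrand s ξ z) ht₀ ?_ ?_ ?_ ?_
  · intro t ht htt
    have h1 := norm_sinIntegrand_zero_le (s := s) (ξ := ξ) z (by linarith) ht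
    have h2 := norm_le_norm_add_norm_sub' (sinIntegrand s ξ z g t) (sinIntegrand s ξ z 0 t)
    linarith [hdiff t ht htt]
  · intro r hr hrt
    have i0 := isConvexCurve_zero.intervalIntegrable_sinIntegrand s ξ z hr ht₀
    have i1 := h.intervalIntegrable_sinIntegrand s ξ z hr ht₀
    have h1 : ∫ t in r..t₀, sinIntegrand s ξ z g t = (∫ t in r..t₀, sinIntegrand s ξ z 0 t) +
        ∫ t in r..t₀, (sinIntegrand s ξ z g t - sinIntegrand s ξ z 0 t) := by
      rw [intervalIntegral.integral_sub i1 i0]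
      ring
    rw [h1]
    refine (norm_add_le _ _).trans (add_le_add
      (norm_integral_sinIntegrand_zero_le hs hz hr hrt) ?_)
    refine (intervalIntegral.norm_integral_le_of_norm_le_const
      (C := 2 * (2 * ‖z‖ + s) / t₀) fun t ht => ?_).trans ?_
    · rw [Set.uIoc_of_le hrt] at ht
      exact hdiff t (hr.trans ht.1) ht.2
    · rw [abs_of_nonneg (by linarith)]
      calc 2 * (2 * ‖z‖ + s) / t₀ * (t₀ - r) ≤ 2 * (2 * ‖z‖ + s) / t₀ * t₀ := by
            gcongr
            linarith
        _ = _ := by field_simp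
  · intro R hR
    refine h.norm_integral_sinIntegrand_le ht₀ (hT0.trans_le hR) hs fun σ hσ => ?_
    rw [← intervalIntegral.integral_add_adjacent_intervals
      (h.intervalIntegrable_oscIntegrand σ ξ z ht₀ hT0)
      (h.intervalIntegrable_oscIntegrand σ ξ z hT0 (hT0.trans_le hR))]
    have hgT : 1 ≤ g T := hgt₀ ▸ h.mono ht₀ hT
    have h1 := h.norm_integral_tail_le hT0 hgT hR hσ hz hz' hK
      fun t ht => hdom t ht.1
    have h2 : 10 * D * (4 / b) / √(g T) ≤ 10 * D * (4 / b) :=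
      div_le_self (by positivity) (Real.one_le_sqrt.2 hgT)
    refine (norm_add_le _ _).trans ((add_le_add (hbound σ hσ) (h1.trans h2)).trans_eq ?_)
    ring
  · intro ε hε
    set E := 2 * (10 * D * (4 / b)) with hE
    have hE0 : 0 < E := by positivity
    have hg1 := h.pos 1 one_pos
    set S := max (max T 1) (max (1 / g 1) ((E / ε) ^ 2 / g 1)) with hS
    have hS1 : 1 ≤ S := (le_max_right _ _).trans (le_max_left _ _)
    have hST : T ≤ S := (le_max_left _ _).trans (le_max_left _ _)
    have hS2 : 1 / g 1 ≤ S := (le_max_left _ _).trans (le_max_right _ _)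
    have hS3 : (E / ε) ^ 2 / g 1 ≤ S := (le_max_right _ _).trans (le_max_right _ _)
    have hS0 : 0 < S := by linarith
    have hgS := h.mul_le hS1
    have hgS1 : 1 ≤ g S := ((div_le_iff₀ hg1).1 hS2).trans hgS
    have hgS2 : (E / ε) ^ 2 ≤ g S := ((div_le_iff₀ hg1).1 hS3).trans hgS
    refine ⟨S, hS0, fun R hR => ?_⟩
    refine (h.norm_integral_sinIntegrand_le hS0 (hS0.trans_le hR) hs fun σ hσ =>
      h.norm_integral_tail_le hS0 hgS1 hR hσ hz hz' hK fun t ht => hdom t (hST.trans ht.1)).trans ?_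
    have hsq : E / ε ≤ √(g S) := Real.le_sqrt_of_sq_le hgS2
    rw [← hD, ← mul_div_assoc, ← hE, div_le_iff₀ (Real.sqrt_pos.2 (by linarith))]
    rw [div_le_iff₀ hε] at hsq
    linarith

lemma setIntegral_annulus {f F : ℝ → ℂ} {a b : ℝ} (ha : 0 < a) (hab : a ≤ b)
    (hF : ContinuousOn F {0}ᶜ) (hf : ∀ t, 0 < t → F t + F (-t) = f t) :
    ∫ t in {t : ℝ | a ≤ |t| ∧ |t| ≤ b}, F t = ∫ t in a..b, f t := by
  have hset : {t : ℝ | a ≤ |t| ∧ |t| ≤ b} = Set.Icc a b ∪ Set.Icc (-b) (-a) := by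
    ext t
    simp only [Set.mem_ofPred_eq, Set.mem_union, Set.mem_Icc, le_abs, abs_le]
    constructor
    · rintro ⟨h | h, h1, h2⟩
      · exact Or.inl ⟨h, h2⟩
      · exact Or.inr ⟨h1, by linarith⟩
    · rintro (⟨h1, h2⟩ | ⟨h1, h2⟩)
      · exact ⟨Or.inl h1, by linarith, h2⟩
      · exact ⟨Or.inr (by linarith), h1, by linarith⟩
  have hdisj : Disjoint (Set.Icc a b) (Set.Icc (-b) (-a)) :=
    Set.disjoint_left.2 fun t h1 h2 => by linarith [h1.1, h2.2]
  have i1 : IntegrableOn F (Set.Icc a b) :=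
    (hF.mono fun t ht => (ha.trans_le ht.1).ne').integrableOn_Icc
  have i2 : IntegrableOn F (Set.Icc (-b) (-a)) :=
    (hF.mono fun t ht => (ht.2.trans_lt (neg_neg_of_pos ha)).ne).integrableOn_Icc
  have i3 : IntervalIntegrable F volume a b :=
    (intervalIntegrable_iff_integrableOn_Icc_of_le hab).2 i1
  have i4 : IntervalIntegrable (fun t => F (-t)) volume a b :=
    (hF.comp continuous_neg.continuousOn fun t ht =>
      neg_ne_zero.2 ((lt_min ha (ha.trans_le hab)).trans_le ht.1).ne').intervalIntegrable
  rw [hset, setIntegral_union hdisj measurableSet_Icc i1 i2, integral_Icc_eq_integral_Ioc,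
    integral_Icc_eq_integral_Ioc, ← intervalIntegral.integral_of_le hab,
    ← intervalIntegral.integral_of_le (neg_le_neg hab), ← intervalIntegral.integral_comp_neg,
    ← intervalIntegral.integral_add i3 i4]
  refine intervalIntegral.integral_congr fun t ht => hf t ?_
  rw [Set.uIcc_of_le hab] at ht
  exact ha.trans_le ht.1

lemma sinIntegrand_neg_curve (s ξ : ℝ) (z : ℂ) (g : ℝ → ℝ) (t : ℝ) :
    sinIntegrand s ξ z (fun u => -g u) t = -sinIntegrand s (-ξ) z g t := by
  simp only [sinIntegrand, oscIntegrand, amplitude, neg_sq]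
  rw [show -s * (ξ * t + -g t) = s * (-ξ * t + g t) by ring,
    show s * (ξ * t + -g t) = -s * (-ξ * t + g t) by ring, neg_sub]

lemma isGrowingCurve_const_mul {γ : ℝ → ℝ} (hodd : ∀ t, γ (-t) = -γ t)
    (hsmooth : ContDiffOn ℝ 2 γ (Set.Ici 0)) (hmono : StrictMonoOn γ (Set.Ici 0))
    (hconv : ConvexOn ℝ (Set.Ici 0) γ) {C₀ : ℝ}
    (hgrow : ∀ t : ℝ, 0 < t → deriv γ t ≤ C₀ * t * deriv (deriv γ) t) {η : ℝ} (hη : 0 < η) :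
    IsGrowingCurve (fun t => η * γ t) (fun t => η * deriv γ t) (fun t => η * deriv (deriv γ) t)
      (max C₀ 1)⁻¹ := by
  have hs : ContDiffOn ℝ 2 γ (Set.Ioi 0) := hsmooth.mono Set.Ioi_subset_Ici_self
  have hd : ∀ t, 0 < t → HasDerivAt γ (deriv γ t) t := fun t ht =>
    ((hs.differentiableOn (by norm_num)).differentiableAt (Ioi_mem_nhds ht)).hasDerivAt
  have hs1 : ContDiffOn ℝ 1 (deriv γ) (Set.Ioi 0) :=
    ((contDiffOn_succ_iff_deriv_of_isOpen (n := 1) isOpen_Ioi).1 (by norm_num; exact hs)).2.2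
  have hdd : ∀ t, 0 < t → HasDerivAt (deriv γ) (deriv (deriv γ) t) t := fun t ht =>
    ((hs1.differentiableOn (by norm_num)).differentiableAt (Ioi_mem_nhds ht)).hasDerivAt
  have h0 : γ 0 = 0 := by
    have := hodd 0
    rw [neg_zero] at this
    linarith
  have hpos : ∀ t, 0 < t → 0 < γ t := fun t ht =>
    h0 ▸ hmono Set.self_mem_Ici ht.le ht
  have htan : ∀ t, 0 < t → γ t ≤ t * deriv γ t := fun t ht => by
    have h1 := hconv.slope_le_of_hasDerivAt Set.self_mem_Ici ht.le ht (hd t ht)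
    rwa [slope_def_field, h0, sub_zero, sub_zero, div_le_iff₀' ht] at h1
  have hd1 : ∀ t, 0 < t → 0 < deriv γ t := fun t ht =>
    pos_of_mul_pos_right ((hpos t ht).trans_le (htan t ht)) ht.le
  have hC : 0 < max C₀ 1 := one_pos.trans_le (le_max_right _ _)
  have hd2 : ∀ t, 0 < t → 0 ≤ deriv (deriv γ) t := fun t ht => by
    have hm : MonotoneOn (deriv γ) (Set.Ioi 0) :=
      (hconv.subset Set.Ioi_subset_Ici_self (convex_Ioi 0)).monotoneOn_deriv
        fun x hx => (hd x hx).differentiableAt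
    rw [← derivWithin_of_isOpen isOpen_Ioi ht]
    exact hm.derivWithin_nonneg
  refine ⟨⟨fun t ht => (hd t ht).const_mul η, fun t ht => (hdd t ht).const_mul η,
    fun t ht => (mul_pos hη (hpos t ht)).le, fun t ht => (mul_pos hη (hd1 t ht)).le,
    fun t ht => mul_nonneg hη.le (hd2 t ht)⟩, inv_pos.2 hC, inv_le_one_of_one_le₀ (le_max_right _ _),
    fun t ht => mul_pos hη (hpos t ht), fun t ht => ?_, fun s t hs hst => ?_, fun t ht => ?_⟩
  · rw [mul_left_comm]
    exact mul_le_mul_of_nonneg_left (htan t ht) hη.le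
  · have ht := hs.trans_le hst
    have h1 := hconv.2 Set.self_mem_Ici (Set.mem_Ici.2 ht.le)
      (sub_nonneg.2 ((div_le_one ht).2 hst)) (by positivity : 0 ≤ s / t) (by ring)
    simp only [smul_eq_mul, mul_zero, zero_add, h0, div_mul_cancel₀ _ ht.ne'] at h1
    have h2 : t * γ s ≤ s * γ t := by
      rw [div_mul_eq_mul_div, le_div_iff₀ ht] at h1
      linarith
    calc t * (η * γ s) = η * (t * γ s) := by ring
      _ ≤ η * (s * γ t) := by gcongr
      _ = s * (η * γ t) := by ring
  · rw [inv_mul_le_iff₀ hC]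
    have h1 : deriv γ t ≤ max C₀ 1 * t * deriv (deriv γ) t := by
      have := hd2 t ht
      refine (hgrow t ht).trans ?_
      gcongr
      exact le_max_left _ _
    calc η * deriv γ t ≤ η * (max C₀ 1 * t * deriv (deriv γ) t) := by gcongr
      _ = _ := by ring

/-- for every `δ ∈ (0, 1/4)` there is `C_δ` such that for `Re z = 1/4 − δ`
the principal value `m_z(ξ,η) = p.v. ∫ e^{−2πi(ξt + ηγ(t))} (1 + η²γ(t)²)^z dt/t`
converges with `|m_z(ξ,η)| ≤ C_δ (1 + |Im z|)`. -/
theorem multiplier_L2_estimate_convex_curve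
    (γ : ℝ → ℝ) (hcont : Continuous γ) (hodd : ∀ t, γ (-t) = -γ t)
    (hsmooth : ContDiffOn ℝ 2 γ (Set.Ici 0))
    (hmono : StrictMonoOn γ (Set.Ici 0)) (hconv : ConvexOn ℝ (Set.Ici 0) γ)
    (h2mono : MonotoneOn (deriv (deriv γ)) (Set.Ioi 0) ∨
      AntitoneOn (deriv (deriv γ)) (Set.Ioi 0))
    (C₀ : ℝ) (hC₀ : 0 < C₀)
    (hgrow : ∀ t : ℝ, 0 < t → deriv γ t ≤ C₀ * t * deriv (deriv γ) t)
    (δ : ℝ) (hδ0 : 0 < δ) (hδ1 : δ < 1/4) :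
    ∃ C : ℝ, ∀ z : ℂ, z.re = 1/4 - δ → ∀ ξ η : ℝ, ∃ m : ℂ,
      Tendsto (fun r : ℝ => ∫ t in {t : ℝ | r ≤ |t| ∧ |t| ≤ r⁻¹},
          Complex.exp (((-(2 * Real.pi * (ξ * t + η * γ t)) : ℝ) : ℂ) * Complex.I) *
            ((1 + η ^ 2 * γ t ^ 2 : ℝ) : ℂ) ^ z / (t : ℂ))
        (𝓝[>] 0) (𝓝 m) ∧
      ‖m‖ ≤ C * (1 + |z.im|) := by
  set a := 1 / 4 - δ with ha
  have ha0 : 0 < a := by linarith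
  set M := max C₀ 1 with hM
  have hM1 : 1 ≤ M := le_max_right _ _
  refine ⟨4000 * M * (3 + 1 / a), fun z hz ξ η => ?_⟩
  have hz0 : 0 < z.re := hz ▸ ha0
  have hz1 : z.re ≤ 1 / 4 := by linarith
  set s := 2 * Real.pi with hs
  have hs1 : 1 ≤ s := by linarith [Real.two_le_pi]
  have hs8 : s ≤ 8 := by linarith [Real.pi_le_four]
  set D := 2 + ‖z‖ / z.re with hD
  have hzD : ‖z‖ ≤ D := by
    have : ‖z‖ ≤ ‖z‖ / z.re := le_div_self (norm_nonneg z) hz0 (by linarith)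
    linarith
  have hD2 : 2 ≤ D := by
    have : 0 ≤ ‖z‖ / z.re := by positivity
    linarith
  have hDle : D ≤ (3 + 1 / a) * (1 + |z.im|) := by
    have h1 : ‖z‖ / z.re ≤ (a + |z.im|) / a := by
      rw [hz]
      gcongr
      have := Complex.norm_le_abs_re_add_abs_im z
      rwa [hz, abs_of_pos ha0] at this
    have h2 : (a + |z.im|) / a = 1 + 1 / a * |z.im| := by field_simp
    have h3 : 0 ≤ 1 / a := by positivity
    have h4 := abs_nonneg z.im
    linarith
  have hDM : D ≤ D * M := le_mul_of_one_le_right (by linarith) hM1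
  have main : ∃ m, Tendsto (fun r : ℝ => ∫ t in r..r⁻¹, sinIntegrand s ξ z (fun u => η * γ u) t)
      (𝓝[>] 0) (𝓝 m) ∧ ‖m‖ ≤ 4000 * (D * M) := by
    have hcurve : ∀ η' : ℝ, 0 < η' → ∀ ξ', ∃ m, Tendsto (fun r : ℝ => ∫ t in r..r⁻¹,
        sinIntegrand s ξ' z (fun u => η' * γ u) t) (𝓝[>] 0) (𝓝 m) ∧ ‖m‖ ≤ 4000 * (D * M) := by
      intro η' hη' ξ'
      obtain ⟨m, hm, hm'⟩ := (isGrowingCurve_const_mul hodd hsmooth hmono hconv hgrow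
        hη').exists_tendsto_integral_sinIntegrand ξ' hs1 hz0 hz1
      refine ⟨m, hm, hm'.trans ?_⟩
      rw [← hD, ← hM, div_inv_eq_mul]
      linarith
    rcases lt_trichotomy η 0 with hη | rfl | hη
    · obtain ⟨m, hm, hm'⟩ := hcurve (-η) (neg_pos.2 hη) (-ξ)
      refine ⟨-m, ?_, by rwa [norm_neg]⟩
      have h1 : ∀ t, sinIntegrand s ξ z (fun u => η * γ u) t =
          -sinIntegrand s (-ξ) z (fun u => -η * γ u) t := fun t => by
        simpa using sinIntegrand_neg_curve s ξ z (fun u => -η * γ u) t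
      simpa only [h1, intervalIntegral.integral_neg] using hm.neg
    · obtain ⟨m, hm, hm'⟩ := exists_tendsto_integral_sinIntegrand_zero ξ hs1 hz0
      refine ⟨m, ?_, hm'.trans ?_⟩
      · have h1 : (fun u => 0 * γ u) = 0 := by
          ext u
          simp
        rwa [h1]
      · rw [← hD]
        linarith
    · exact hcurve η hη ξ
  obtain ⟨m, hm, hm'⟩ := main
  refine ⟨m, hm.congr' ?_, hm'.trans ?_⟩
  · filter_upwards [Ioc_mem_nhdsGT one_pos] with r hr
    symm
    refine setIntegral_annulus hr.1 (hr.2.trans (one_le_inv₀ hr.1 |>.2 hr.2)) ?_ fun t ht => ?_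
    · intro t ht
      have ht' : (t : ℂ) ≠ 0 := by exact_mod_cast ht
      refine ContinuousAt.continuousWithinAt ?_
      refine ContinuousAt.div (ContinuousAt.mul (by fun_prop) ?_)
        Complex.continuous_ofReal.continuousAt ht'
      exact ContinuousAt.cpow (by fun_prop) continuousAt_const
        (Complex.ofReal_mem_slitPlane.2 (by positivity))
    · simp only [sinIntegrand, oscIntegrand, amplitude, hodd, neg_sq, mul_pow, Complex.ofReal_neg,
        div_neg]
      rw [← sub_eq_add_neg]
      congr 5 <;> push_cast <;> ring
  · calc 4000 * (D * M) = 4000 * M * D := by ring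
      _ ≤ 4000 * M * ((3 + 1 / a) * (1 + |z.im|)) := by gcongr
      _ = _ := by ring
end

section
/- For every z ∈ ℂ with Re z < −1 and every (ξ, η) ∈ ℝ², the principal value integral m_z(ξ,η) = p.v. ∫_ℝ e^{−2πi(ξt + ηγ(t))} (1 + η²γ(t)²)^z dt/t converges and |m_z(ξ,η)| ≤ C (1 + |Im z|), where C depends only on Re z and γ (not on ξ, η, or Im z). -/
open MeasureTheory Topology Filter

lemma integral_sinc_eq_of_one_le {A : ℝ} (hA : 1 ≤ A) :
    ∫ x in (0 : ℝ)..A, Real.sinc x = (∫ x in (0 : ℝ)..1, Real.sinc x) +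
      (Real.cos 1 - Real.cos A * A⁻¹ - ∫ x in (1 : ℝ)..A, Real.cos x * x ^ (-2 : ℝ)) := by
  have hpos : ∀ x ∈ Set.uIcc 1 A, 0 < x := fun x hx => by
    rw [Set.uIcc_of_le hA] at hx; linarith [hx.1]
  have hint : IntervalIntegrable (fun x : ℝ => Real.cos x * x ^ (-2 : ℝ)) volume 1 A :=
    (Real.continuous_cos.continuousOn.mul
      (continuousOn_id.rpow_const fun x hx => Or.inl (hpos x hx).ne')).intervalIntegrable
  have hsinc (a b : ℝ) : IntervalIntegrable Real.sinc volume a b :=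
    Real.continuous_sinc.intervalIntegrable a b
  have hftc : ∫ x in (1 : ℝ)..A, (Real.sinc x + Real.cos x * x ^ (-2 : ℝ)) =
      -(Real.cos A * A⁻¹) - -(Real.cos 1 * 1⁻¹) := by
    refine intervalIntegral.integral_eq_sub_of_hasDerivAt (f := fun x => -(Real.cos x * x⁻¹))
      (fun x hx => ?_) ((hsinc 1 A).add hint)
    have hx0 := hpos x hx
    refine ((Real.hasDerivAt_cos x).mul (hasDerivAt_inv hx0.ne')).neg.congr_deriv ?_
    rw [Real.sinc_of_ne_zero hx0.ne', Real.rpow_neg hx0.le, Real.rpow_two]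
    field_simp
    ring
  rw [intervalIntegral.integral_add (hsinc 1 A) hint] at hftc
  rw [← intervalIntegral.integral_add_adjacent_intervals (hsinc 0 1) (hsinc 1 A)]
  simp only [inv_one, mul_one] at hftc
  linarith

lemma integrableOn_cos_mul_rpow_neg_two :
    IntegrableOn (fun x : ℝ => Real.cos x * x ^ (-2 : ℝ)) (Set.Ioi 1) := by
  refine (integrableOn_Ioi_rpow_of_lt (a := -2) (by norm_num) one_pos).bdd_mul (c := 1)
    Real.continuous_cos.aestronglyMeasurable ?_
  exact ae_of_all _ fun x => Real.abs_cos_le_one x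

lemma tendsto_integral_sinc_atTop :
    ∃ L : ℝ, Tendsto (fun A : ℝ => ∫ x in (0 : ℝ)..A, Real.sinc x) atTop (𝓝 L) := by
  have hcos : Tendsto (fun A : ℝ => Real.cos A * A⁻¹) atTop (𝓝 0) := by
    refine squeeze_zero_norm' ?_ tendsto_inv_atTop_zero
    filter_upwards [eventually_gt_atTop 0] with A hA
    rw [norm_mul, Real.norm_of_nonneg (inv_pos.2 hA).le]
    exact mul_le_of_le_one_left (inv_pos.2 hA).le (Real.abs_cos_le_one A)
  have hint := intervalIntegral_tendsto_integral_Ioi 1 integrableOn_cos_mul_rpow_neg_two tendsto_id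
  refine ⟨_, (((hcos.const_sub (Real.cos 1)).sub hint).const_add
    (∫ x in (0 : ℝ)..1, Real.sinc x)).congr' ?_⟩
  filter_upwards [eventually_ge_atTop 1] with A hA using (integral_sinc_eq_of_one_le hA).symm

lemma abs_integral_sinc_le_abs (A : ℝ) : |∫ x in (0 : ℝ)..A, Real.sinc x| ≤ |A| := by
  simpa using intervalIntegral.norm_integral_le_of_norm_le_const (a := 0) (b := A)
    (f := Real.sinc) (C := 1) fun x _ => Real.abs_sinc_le_one x

lemma integral_sinc_neg (A : ℝ) :
    ∫ x in (0 : ℝ)..(-A), Real.sinc x = -∫ x in (0 : ℝ)..A, Real.sinc x := by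
  have h := intervalIntegral.integral_comp_neg (a := 0) (b := A) Real.sinc
  simp only [Real.sinc_neg, neg_zero] at h
  rw [h, intervalIntegral.integral_symm]

lemma abs_integral_sinc_le (A : ℝ) : |∫ x in (0 : ℝ)..A, Real.sinc x| ≤ 4 := by
  wlog hA : 0 ≤ A generalizing A
  · simpa [integral_sinc_neg] using this (-A) (by linarith)
  rcases le_total A 1 with h1 | h1
  · have := abs_integral_sinc_le_abs A
    rw [abs_of_nonneg hA] at this
    linarith
  have hpow : |∫ x in (1 : ℝ)..A, Real.cos x * x ^ (-2 : ℝ)| ≤ 1 := by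
    rw [intervalIntegral.integral_of_le h1]
    refine (norm_integral_le_integral_norm (G := ℝ) _).trans ?_
    have hle : ∫ x in Set.Ioi (1 : ℝ), ‖Real.cos x * x ^ (-2 : ℝ)‖ ≤
        ∫ x in Set.Ioi (1 : ℝ), x ^ (-2 : ℝ) := by
      refine setIntegral_mono_on integrableOn_cos_mul_rpow_neg_two.norm
        (integrableOn_Ioi_rpow_of_lt (by norm_num) one_pos) measurableSet_Ioi fun x hx => ?_
      have hx0 : 0 ≤ x ^ (-2 : ℝ) := Real.rpow_nonneg (zero_le_one.trans (Set.mem_Ioi.1 hx).le) _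
      rw [norm_mul, Real.norm_of_nonneg hx0]
      exact mul_le_of_le_one_left hx0 (Real.abs_cos_le_one x)
    rw [integral_Ioi_rpow_of_lt (by norm_num) one_pos] at hle
    refine (setIntegral_mono_set integrableOn_cos_mul_rpow_neg_two.norm
      (ae_of_all _ fun x => norm_nonneg _) Set.Ioc_subset_Ioi_self.eventuallyLE).trans
      (hle.trans ?_)
    norm_num
  have hcos : |Real.cos A * A⁻¹| ≤ 1 := by
    rw [abs_mul, abs_inv, abs_of_nonneg hA]
    exact mul_le_one₀ (Real.abs_cos_le_one A) (inv_nonneg.2 hA) (inv_le_one_of_one_le₀ h1)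
  have h01 := abs_integral_sinc_le_abs 1
  rw [abs_one] at h01
  have hc1 := Real.abs_cos_le_one 1
  rw [integral_sinc_eq_of_one_le h1]
  rw [abs_le] at *
  constructor <;> linarith [hpow.1, hpow.2, hcos.1, hcos.2, h01.1, h01.2, hc1.1, hc1.2]

lemma norm_exp_sub_one_le_of_re_nonpos {w : ℂ} (hw : w.re ≤ 0) :
    ‖Complex.exp w - 1‖ ≤ 2 * ‖w‖ := by
  rcases le_total ‖w‖ 1 with h | h
  · exact Complex.norm_exp_sub_one_le h
  · have := norm_sub_le (Complex.exp w) 1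
    rw [Complex.norm_exp, norm_one] at this
    linarith [Real.exp_le_one_iff.2 hw]

lemma norm_one_add_cpow_sub_one_le {x : ℝ} (hx : 0 ≤ x) {z : ℂ} (hz : z.re ≤ 0) :
    ‖((1 + x : ℝ) : ℂ) ^ z - 1‖ ≤ 2 * ‖z‖ * x := by
  have h1 : (0 : ℝ) < 1 + x := by linarith
  have hlog : 0 ≤ Real.log (1 + x) := Real.log_nonneg (by linarith)
  rw [Complex.cpow_def_of_ne_zero (by exact_mod_cast h1.ne'), ← Complex.ofReal_log h1.le]
  refine (norm_exp_sub_one_le_of_re_nonpos ?_).trans ?_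
  · rw [Complex.re_ofReal_mul]
    exact mul_nonpos_of_nonneg_of_nonpos hlog hz
  · rw [norm_mul, Complex.norm_real, Real.norm_of_nonneg hlog]
    have := Real.log_le_sub_one_of_pos h1
    nlinarith [norm_nonneg z]

lemma norm_one_add_cpow_le_inv {x : ℝ} (hx : 0 < x) {z : ℂ} (hz : z.re ≤ -1) :
    ‖((1 + x : ℝ) : ℂ) ^ z‖ ≤ x⁻¹ := by
  have h1 : (0 : ℝ) < 1 + x := by linarith
  rw [Complex.norm_cpow_eq_rpow_re_of_pos h1]
  calc (1 + x) ^ z.re ≤ (1 + x) ^ (-1 : ℝ) :=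
        Real.rpow_le_rpow_of_exponent_le (by linarith) hz
    _ = (1 + x)⁻¹ := Real.rpow_neg_one _
    _ ≤ x⁻¹ := inv_anti₀ hx (by linarith)

lemma norm_one_add_cpow_le_one {x : ℝ} (hx : 0 ≤ x) {z : ℂ} (hz : z.re ≤ 0) :
    ‖((1 + x : ℝ) : ℂ) ^ z‖ ≤ 1 := by
  rw [Complex.norm_cpow_eq_rpow_re_of_pos (by linarith)]
  exact Real.rpow_le_one_of_one_le_of_nonpos (by linarith) hz

/-- Folding a truncated principal value integral onto the positive half-line. -/
lemma setIntegral_abs_mem_Icc_eq {f : ℝ → ℂ} (hf : ContinuousOn f {0}ᶜ) {r R : ℝ} (hr : 0 < r) :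
    ∫ t in {t : ℝ | r ≤ |t| ∧ |t| ≤ R}, f t = ∫ t in Set.Icc r R, (f t + f (-t)) := by
  have hset : {t : ℝ | r ≤ |t| ∧ |t| ≤ R} = Set.Icc r R ∪ Set.Icc (-R) (-r) := by
    ext t
    simp only [Set.mem_ofPred_eq, Set.mem_union, Set.mem_Icc]
    rcases abs_cases t with ⟨h, h'⟩ | ⟨h, h'⟩ <;> rw [h] <;> constructor
    · exact fun h => Or.inl h
    · rintro (h | h)
      · exact h
      · linarith
    · exact fun h => Or.inr ⟨by linarith, by linarith⟩
    · rintro (h | h)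
      · linarith
      · exact ⟨by linarith, by linarith⟩
  have hdisj : Disjoint (Set.Icc r R) (Set.Icc (-R) (-r)) :=
    Set.disjoint_left.2 fun t h h' => by linarith [h.1, h'.2]
  have hpos : IntegrableOn f (Set.Icc r R) :=
    (hf.mono fun t ht => (hr.trans_le ht.1).ne').integrableOn_Icc
  have hneg : IntegrableOn f (Set.Icc (-R) (-r)) :=
    (hf.mono fun t ht => (show t < 0 by linarith [ht.2]).ne).integrableOn_Icc
  have hpre : (fun t : ℝ => -t) ⁻¹' Set.Icc (-R) (-r) = Set.Icc r R := by simp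
  have hmp := Measure.measurePreserving_neg (volume : Measure ℝ)
  have hemb : MeasurableEmbedding (fun t : ℝ => -t) :=
    (Homeomorph.neg ℝ).measurableEmbedding
  have hneg' : IntegrableOn (fun t => f (-t)) (Set.Icc r R) := by
    rw [← hpre]
    exact (hmp.integrableOn_comp_preimage hemb).2 hneg
  rw [hset, setIntegral_union hdisj measurableSet_Icc hpos hneg, integral_add hpos hneg',
    ← hmp.setIntegral_preimage_emb hemb f (Set.Icc (-R) (-r))]
  exact congrArg _ (congrArg (fun s => ∫ t in s, f (-t)) hpre)

lemma integral_Ioc_mul_sinc (w : ℝ) {a b : ℝ} (hab : a ≤ b) :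
    ∫ t in Set.Ioc a b, w * Real.sinc (w * t) =
      (∫ x in (0 : ℝ)..(w * b), Real.sinc x) - ∫ x in (0 : ℝ)..(w * a), Real.sinc x := by
  rw [← intervalIntegral.integral_of_le hab, intervalIntegral.integral_const_mul,
    intervalIntegral.mul_integral_comp_mul_left, intervalIntegral.integral_interval_sub_left] <;>
  exact Real.continuous_sinc.intervalIntegrable _ _

lemma mul_sinc_mul_eq {w t : ℝ} (ht : t ≠ 0) : w * Real.sinc (w * t) = Real.sin (w * t) / t := by
  rcases eq_or_ne w 0 with rfl | hw
  · simp
  · rw [Real.sinc_of_ne_zero (mul_ne_zero hw ht)]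
    field_simp

lemma continuous_integral_sinc : Continuous fun A : ℝ => ∫ x in (0 : ℝ)..A, Real.sinc x :=
  intervalIntegral.continuous_primitive
    (fun a b => Real.continuous_sinc.intervalIntegrable a b) 0

lemma exists_tendsto_integral_Icc_mul_sinc (w : ℝ) :
    ∃ L : ℝ, Tendsto (fun r : ℝ => ∫ t in Set.Icc r r⁻¹, w * Real.sinc (w * t))
      (𝓝[>] 0) (𝓝 L) ∧ |L| ≤ 8 := by
  have hev : ∀ᶠ r : ℝ in 𝓝[>] 0, (∫ x in (0 : ℝ)..(w * r⁻¹), Real.sinc x) -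
      (∫ x in (0 : ℝ)..(w * r), Real.sinc x) =
      ∫ t in Set.Icc r r⁻¹, w * Real.sinc (w * t) := by
    filter_upwards [Ioo_mem_nhdsGT one_pos] with r hr
    rw [integral_Icc_eq_integral_Ioc,
      integral_Ioc_mul_sinc w (hr.2.le.trans ((one_le_inv₀ hr.1).2 hr.2.le))]
  have hsmall : Tendsto (fun r : ℝ => ∫ x in (0 : ℝ)..(w * r), Real.sinc x) (𝓝[>] 0) (𝓝 0) := by
    have := (continuous_integral_sinc.comp (continuous_const_mul w)).tendsto 0
    simp only [Function.comp_apply, mul_zero, intervalIntegral.integral_same] at this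
    exact this.mono_left nhdsWithin_le_nhds
  obtain ⟨L, hL⟩ := tendsto_integral_sinc_atTop
  have hlarge : ∃ L' : ℝ, Tendsto (fun r : ℝ => ∫ x in (0 : ℝ)..(w * r⁻¹), Real.sinc x)
      (𝓝[>] 0) (𝓝 L') := by
    rcases lt_trichotomy w 0 with hw | rfl | hw
    · refine ⟨-L, ?_⟩
      refine ((hL.comp (tendsto_inv_nhdsGT_zero.const_mul_atTop (neg_pos.2 hw))).neg).congr
        fun r => ?_
      simp only [Function.comp_apply, neg_mul, integral_sinc_neg, neg_neg]
    · exact ⟨0, by simp⟩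
    · exact ⟨L, hL.comp (tendsto_inv_nhdsGT_zero.const_mul_atTop hw)⟩
  obtain ⟨L', hL'⟩ := hlarge
  refine ⟨L' - 0, (hL'.sub hsmall).congr' hev, ?_⟩
  refine le_of_tendsto (hL'.sub hsmall).abs (Eventually.of_forall fun r => ?_)
  have h1 := abs_integral_sinc_le (w * r⁻¹)
  have h2 := abs_integral_sinc_le (w * r)
  exact (abs_sub _ _).trans (by linarith)

/-- The odd part of the multiplier integrand along the curve `t ↦ (t, h t)`. -/
noncomputable def foldedIntegrand (h : ℝ → ℝ) (w : ℝ) (z : ℂ) (t : ℝ) : ℂ :=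
  (Real.sin (w * t + 2 * Real.pi * h t) : ℂ) * ((1 + h t ^ 2 : ℝ) : ℂ) ^ z / (t : ℂ)

lemma continuousOn_foldedIntegrand {h : ℝ → ℝ} (hh : Continuous h) (w : ℝ) (z : ℂ) :
    ContinuousOn (foldedIntegrand h w z) {0}ᶜ := by
  have hbase : Continuous fun t => ((1 + h t ^ 2 : ℝ) : ℂ) ^ z := by
    refine Continuous.cpow (by fun_prop) continuous_const fun t => Or.inl ?_
    rw [Complex.ofReal_re]
    positivity
  refine ContinuousOn.div ?_ Complex.continuous_ofReal.continuousOn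
    fun t ht => Complex.ofReal_ne_zero.2 ht
  exact (Continuous.mul (by fun_prop) hbase).continuousOn

lemma norm_foldedIntegrand_sub_le {h : ℝ → ℝ} {w t t₀ : ℝ} {z : ℂ} (hz : z.re ≤ 0)
    (ht : 0 < t) (htt₀ : t ≤ t₀) (hle : |h t| ≤ t / t₀) :
    ‖foldedIntegrand h w z t - (w * Real.sinc (w * t) : ℝ)‖ ≤
      (2 * Real.pi + 2 * ‖z‖) / t₀ := by
  have ht₀ : 0 < t₀ := ht.trans_le htt₀
  set g : ℂ := ((1 + h t ^ 2 : ℝ) : ℂ) ^ z with hg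
  have hdecomp : foldedIntegrand h w z t - (w * Real.sinc (w * t) : ℝ) =
      ((Real.sin (w * t + 2 * Real.pi * h t) - Real.sin (w * t) : ℝ) * g +
        (Real.sin (w * t) : ℝ) * (g - 1)) / (t : ℂ) := by
    rw [mul_sinc_mul_eq ht.ne', foldedIntegrand, ← hg]
    push_cast
    ring
  have hsin : |Real.sin (w * t + 2 * Real.pi * h t) - Real.sin (w * t)| ≤
      2 * Real.pi * (t / t₀) := by
    refine (Real.abs_sin_sub_sin_le _ _).trans ?_
    rw [add_sub_cancel_left, abs_mul, abs_of_pos Real.two_pi_pos]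
    gcongr
  have hsq : h t ^ 2 ≤ t / t₀ := by
    have h1 : t / t₀ ≤ 1 := (div_le_one ht₀).2 htt₀
    rw [← sq_abs]
    nlinarith [abs_nonneg (h t)]
  have hg1 : ‖g‖ ≤ 1 := norm_one_add_cpow_le_one (sq_nonneg _) hz
  have hg2 : ‖g - 1‖ ≤ 2 * ‖z‖ * (t / t₀) :=
    (norm_one_add_cpow_sub_one_le (sq_nonneg _) hz).trans (by gcongr)
  rw [hdecomp, norm_div, Complex.norm_real, Real.norm_of_nonneg ht.le, div_le_iff₀ ht]
  refine (norm_add_le _ _).trans ?_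
  rw [norm_mul, norm_mul, Complex.norm_real, Complex.norm_real]
  have e1 := mul_le_mul hsin hg1 (norm_nonneg g) (by positivity)
  have e2 := mul_le_mul (Real.abs_sin_le_one (w * t)) hg2 (norm_nonneg _) zero_le_one
  refine (add_le_add e1 e2).trans_eq ?_
  field_simp

lemma norm_foldedIntegrand_le {h : ℝ → ℝ} {w t t₀ : ℝ} {z : ℂ} (hz : z.re ≤ -1)
    (ht₀ : 0 < t₀) (htt₀ : t₀ ≤ t) (hge : t / t₀ ≤ |h t|) :
    ‖foldedIntegrand h w z t‖ ≤ t₀ * t ^ (-2 : ℝ) := by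
  have ht : 0 < t := ht₀.trans_le htt₀
  have h1 : 1 ≤ t / t₀ := (one_le_div ht₀).2 htt₀
  have hsq : t / t₀ ≤ h t ^ 2 := by
    rw [← sq_abs]
    nlinarith
  have hpos : 0 < t / t₀ := by positivity
  have hg : ‖((1 + h t ^ 2 : ℝ) : ℂ) ^ z‖ ≤ (t / t₀)⁻¹ :=
    (norm_one_add_cpow_le_inv (hpos.trans_le hsq) hz).trans (inv_anti₀ hpos hsq)
  rw [foldedIntegrand, norm_div, norm_mul, Complex.norm_real, Complex.norm_real,
    Real.norm_of_nonneg ht.le, div_le_iff₀ ht, Real.rpow_neg ht.le, Real.rpow_two]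
  refine (mul_le_mul (Real.abs_sin_le_one _) hg (norm_nonneg _) zero_le_one).trans_eq ?_
  field_simp

lemma integrableOn_foldedIntegrand_and_norm_integral_le {h : ℝ → ℝ} (hh : Continuous h) {t₀ : ℝ}
    (ht₀ : 0 < t₀) (hle : ∀ t, 0 < t → t ≤ t₀ → |h t| ≤ t / t₀)
    (hge : ∀ t, t₀ ≤ t → t / t₀ ≤ |h t|) (w : ℝ) {z : ℂ} (hz : z.re ≤ -1) :
    IntegrableOn (foldedIntegrand h w z) (Set.Ioi 0) ∧
      ‖∫ t in Set.Ioi 0, foldedIntegrand h w z t‖ ≤ 2 * Real.pi + 2 * ‖z‖ + 5 := by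
  have hz0 : z.re ≤ 0 := by linarith
  have hcontOn := continuousOn_foldedIntegrand hh w z
  have hcont : Continuous fun t : ℝ => ((w * Real.sinc (w * t) : ℝ) : ℂ) := by fun_prop
  have hsinc : IntegrableOn (fun t : ℝ => ((w * Real.sinc (w * t) : ℝ) : ℂ)) (Set.Ioc 0 t₀) :=
    (hcont.continuousOn.integrableOn_Icc).mono_set Set.Ioc_subset_Icc_self
  have hbound : ∀ t ∈ Set.Ioc 0 t₀, ‖foldedIntegrand h w z t - (w * Real.sinc (w * t) : ℝ)‖ ≤
      (2 * Real.pi + 2 * ‖z‖) / t₀ := fun t ht =>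
    norm_foldedIntegrand_sub_le hz0 ht.1 ht.2 (hle t ht.1 ht.2)
  have hdiff : IntegrableOn
      (fun t => foldedIntegrand h w z t - (w * Real.sinc (w * t) : ℝ)) (Set.Ioc 0 t₀) := by
    refine IntegrableOn.of_bound (by simp) (ContinuousOn.aestronglyMeasurable
      ((hcontOn.mono fun t ht => ht.1.ne').sub hcont.continuousOn) measurableSet_Ioc) _
      ((ae_restrict_iff' measurableSet_Ioc).2 (ae_of_all _ hbound))
  have hnear : IntegrableOn (foldedIntegrand h w z) (Set.Ioc 0 t₀) :=
    (hdiff.add hsinc).congr_fun (fun t _ => by simp) measurableSet_Ioc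
  have htail : ∀ t ∈ Set.Ioi t₀, ‖foldedIntegrand h w z t‖ ≤ t₀ * t ^ (-2 : ℝ) := fun t ht =>
    norm_foldedIntegrand_le hz ht₀ (le_of_lt ht) (hge t (le_of_lt ht))
  have hdom : IntegrableOn (fun t : ℝ => t₀ * t ^ (-2 : ℝ)) (Set.Ioi t₀) :=
    (integrableOn_Ioi_rpow_of_lt (by norm_num) ht₀).const_mul t₀
  have hfar : IntegrableOn (foldedIntegrand h w z) (Set.Ioi t₀) :=
    Integrable.mono' hdom (ContinuousOn.aestronglyMeasurable
      (hcontOn.mono fun t ht => (ht₀.trans ht).ne') measurableSet_Ioi)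
      ((ae_restrict_iff' measurableSet_Ioi).2 (ae_of_all _ htail))
  have hunion : Set.Ioc 0 t₀ ∪ Set.Ioi t₀ = Set.Ioi 0 := Set.Ioc_union_Ioi_eq_Ioi ht₀.le
  refine ⟨hunion ▸ hnear.union hfar, ?_⟩
  have hfar_le : ‖∫ t in Set.Ioi t₀, foldedIntegrand h w z t‖ ≤ 1 := by
    refine (norm_integral_le_of_norm_le hdom
      ((ae_restrict_iff' measurableSet_Ioi).2 (ae_of_all _ htail))).trans_eq ?_
    rw [integral_const_mul, integral_Ioi_rpow_of_lt (by norm_num) ht₀]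
    norm_num
    rw [Real.rpow_neg_one]
    field_simp
  have hdiff_le : ‖∫ t in Set.Ioc 0 t₀,
      (foldedIntegrand h w z t - (w * Real.sinc (w * t) : ℝ))‖ ≤ 2 * Real.pi + 2 * ‖z‖ := by
    refine (norm_setIntegral_le_of_norm_le_const (by simp) hbound).trans_eq ?_
    rw [Real.volume_real_Ioc_of_le ht₀.le, sub_zero, div_mul_cancel₀ _ ht₀.ne']
  have hsinc_le : ‖∫ t in Set.Ioc 0 t₀, ((w * Real.sinc (w * t) : ℝ) : ℂ)‖ ≤ 4 := by
    rw [integral_complex_ofReal, integral_Ioc_mul_sinc w ht₀.le, Complex.norm_real]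
    simpa using abs_integral_sinc_le (w * t₀)
  have hsplit : ∫ t in Set.Ioc 0 t₀, foldedIntegrand h w z t =
      (∫ t in Set.Ioc 0 t₀, (foldedIntegrand h w z t - (w * Real.sinc (w * t) : ℝ))) +
        ∫ t in Set.Ioc 0 t₀, ((w * Real.sinc (w * t) : ℝ) : ℂ) := by
    rw [← integral_add hdiff hsinc]
    simp
  rw [← hunion, setIntegral_union (Set.Ioc_disjoint_Ioi le_rfl) measurableSet_Ioi hnear hfar,
    hsplit]
  refine (norm_add₃_le).trans ?_
  linarith

lemma tendsto_integral_Icc_inv {f : ℝ → ℂ} (hf : IntegrableOn f (Set.Ioi 0)) :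
    Tendsto (fun r : ℝ => ∫ t in Set.Icc r r⁻¹, f t) (𝓝[>] 0) (𝓝 (∫ t in Set.Ioi 0, f t)) := by
  have hcover : AECover (volume.restrict (Set.Ioi (0 : ℝ))) (𝓝[>] 0)
      fun r : ℝ => Set.Icc r r⁻¹ :=
    (aecover_Ioi_of_Ici (tendsto_id.mono_left nhdsWithin_le_nhds)).inter
      ((aecover_Iic tendsto_inv_nhdsGT_zero).mono Measure.restrict_le_self)
  refine (hcover.integral_tendsto_of_countably_generated hf).congr' ?_
  filter_upwards [self_mem_nhdsWithin] with r hr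
  rw [Measure.restrict_restrict measurableSet_Icc,
    Set.inter_eq_left.2 fun t ht => Set.mem_Ioi.2 (lt_of_lt_of_le hr ht.1)]

/-- A convex function vanishing at the origin crosses any positive level linearly. -/
lemma exists_scale_of_convexOn {γ : ℝ → ℝ} (hcont : Continuous γ) (h0 : γ 0 = 0)
    (hmono : StrictMonoOn γ (Set.Ici 0)) (hconv : ConvexOn ℝ (Set.Ici 0) γ)
    {c : ℝ} (hc : c ≠ 0) :
    ∃ t₀ : ℝ, 0 < t₀ ∧ (∀ t, 0 < t → t ≤ t₀ → |c * γ t| ≤ t / t₀) ∧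
      ∀ t, t₀ ≤ t → t / t₀ ≤ |c * γ t| := by
  have hc' : 0 < |c| := abs_pos.2 hc
  have hγpos : ∀ t, 0 < t → 0 < γ t := fun t ht => by
    simpa [h0] using hmono Set.self_mem_Ici (Set.mem_Ici.2 ht.le) ht
  have hstar : ∀ s t, 0 < s → s ≤ t → γ s ≤ s / t * γ t := fun s t hs hst => by
    have ht : 0 < t := hs.trans_le hst
    have := hconv.2 (Set.mem_Ici.2 ht.le) (Set.self_mem_Ici (a := (0 : ℝ)))
      (div_nonneg hs.le ht.le) (sub_nonneg.2 ((div_le_one ht).2 hst)) (by ring)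
    simpa [h0, div_mul_cancel₀ s ht.ne'] using this
  have habs : ∀ t, 0 < t → |c * γ t| = |c| * γ t := fun t ht => by
    rw [abs_mul, abs_of_pos (hγpos t ht)]
  have hγ1 := hγpos 1 one_pos
  set T : ℝ := max 1 (|c| * γ 1)⁻¹
  have hT : 1 ≤ |c| * γ T := by
    have h1T : (1 : ℝ) ≤ T := le_max_left _ _
    have h2T : (|c| * γ 1)⁻¹ ≤ T := le_max_right _ _
    have := hstar 1 T one_pos h1T
    have hT0 : 0 < T := one_pos.trans_le h1T
    rw [div_mul_eq_mul_div, one_mul, le_div_iff₀ hT0] at this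
    rw [inv_le_iff_one_le_mul₀ (by positivity)] at h2T
    nlinarith
  obtain ⟨t₀, ht₀, heq⟩ := intermediate_value_Icc (f := fun t => |c| * γ t)
    (zero_le_one.trans (le_max_left 1 (|c| * γ 1)⁻¹)) (by fun_prop)
    (show (1 : ℝ) ∈ Set.Icc (|c| * γ 0) (|c| * γ T) from ⟨by simp [h0], hT⟩)
  have ht₀pos : 0 < t₀ := by
    refine lt_of_le_of_ne ht₀.1 fun h => ?_
    simp [← h, h0] at heq
  simp only at heq
  refine ⟨t₀, ht₀pos, fun t ht htt₀ => ?_, fun t htt₀ => ?_⟩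
  · rw [habs t ht]
    have := mul_le_mul_of_nonneg_left (hstar t t₀ ht htt₀) hc'.le
    rwa [mul_left_comm, heq, mul_one] at this
  · have ht := ht₀pos.trans_le htt₀
    rw [habs t ht]
    have := mul_le_mul_of_nonneg_left (hstar t₀ t ht₀pos htt₀) hc'.le
    rw [heq] at this
    rw [div_le_iff₀ ht₀pos]
    field_simp at this
    linarith

lemma exists_tendsto_integral_foldedIntegrand {γ : ℝ → ℝ} (hcont : Continuous γ) (h0 : γ 0 = 0)
    (hmono : StrictMonoOn γ (Set.Ici 0)) (hconv : ConvexOn ℝ (Set.Ici 0) γ)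
    (w η : ℝ) {z : ℂ} (hz : z.re ≤ -1) :
    ∃ m : ℂ, Tendsto (fun r : ℝ => ∫ t in Set.Icc r r⁻¹,
        foldedIntegrand (fun t => η * γ t) w z t) (𝓝[>] 0) (𝓝 m) ∧
      ‖m‖ ≤ 2 * Real.pi + 2 * ‖z‖ + 8 := by
  rcases eq_or_ne η 0 with rfl | hη
  · obtain ⟨L, hL, hL8⟩ := exists_tendsto_integral_Icc_mul_sinc w
    refine ⟨L, ((Complex.continuous_ofReal.tendsto L).comp hL).congr' ?_, ?_⟩
    · filter_upwards [self_mem_nhdsWithin] with r hr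
      rw [Function.comp_apply, ← integral_complex_ofReal]
      refine setIntegral_congr_fun measurableSet_Icc fun t ht => ?_
      have ht0 : t ≠ 0 := (lt_of_lt_of_le hr ht.1).ne'
      simp only [mul_sinc_mul_eq ht0, foldedIntegrand]
      simp
    · rw [Complex.norm_real]
      exact hL8.trans (by linarith [Real.pi_pos, norm_nonneg z])
  · obtain ⟨t₀, ht₀, hle, hge⟩ := exists_scale_of_convexOn hcont h0 hmono hconv hη
    obtain ⟨hint, hnorm⟩ := integrableOn_foldedIntegrand_and_norm_integral_le
      (h := fun t => η * γ t) (by fun_prop) ht₀ hle hge w hz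
    exact ⟨_, tendsto_integral_Icc_inv hint, by linarith⟩

lemma exp_neg_mul_I_sub_exp_mul_I (θ : ℝ) :
    Complex.exp (((-θ : ℝ) : ℂ) * Complex.I) - Complex.exp ((θ : ℂ) * Complex.I) =
      -2 * Complex.I * (Real.sin θ : ℂ) := by
  rw [Complex.exp_mul_I, Complex.exp_mul_I]
  push_cast
  rw [Complex.cos_neg, Complex.sin_neg]
  ring

/-- for every `Re z < −1` the principal value
`m_z(ξ,η) = p.v. ∫ e^{−2πi(ξt + ηγ(t))} (1 + η²γ(t)²)^z dt/t` converges with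
`|m_z(ξ,η)| ≤ C (1 + |Im z|)`, where `C` depends only on `Re z` and `γ`. -/
theorem multiplier_uniform_bound_convex_curve
    (γ : ℝ → ℝ) (hcont : Continuous γ) (hodd : ∀ t, γ (-t) = -γ t)
    (hsmooth : ContDiffOn ℝ 2 γ (Set.Ici 0))
    (hmono : StrictMonoOn γ (Set.Ici 0)) (hconv : ConvexOn ℝ (Set.Ici 0) γ)
    (h2mono : MonotoneOn (deriv (deriv γ)) (Set.Ioi 0) ∨
      AntitoneOn (deriv (deriv γ)) (Set.Ioi 0))
    (C₀ : ℝ) (hC₀ : 0 < C₀)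
    (hgrow : ∀ t : ℝ, 0 < t → deriv γ t ≤ C₀ * t * deriv (deriv γ) t) :
    ∀ a : ℝ, a < -1 → ∃ C : ℝ, ∀ z : ℂ, z.re = a → ∀ ξ η : ℝ, ∃ m : ℂ,
      Tendsto (fun r : ℝ => ∫ t in {t : ℝ | r ≤ |t| ∧ |t| ≤ r⁻¹},
          Complex.exp (((-(2 * Real.pi * (ξ * t + η * γ t)) : ℝ) : ℂ) * Complex.I) *
            ((1 + η ^ 2 * γ t ^ 2 : ℝ) : ℂ) ^ z / (t : ℂ))
        (𝓝[>] 0) (𝓝 m) ∧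
      ‖m‖ ≤ C * (1 + |z.im|) := by
  intro a ha
  refine ⟨2 * (2 * Real.pi + 2 * |a| + 8) + 4, fun z hz ξ η => ?_⟩
  have h0 : γ 0 = 0 := by
    have := hodd 0
    rw [neg_zero] at this
    linarith
  obtain ⟨m, hm, hm_le⟩ := exists_tendsto_integral_foldedIntegrand hcont h0 hmono hconv
    (2 * Real.pi * ξ) η (z := z) (by linarith)
  refine ⟨-2 * Complex.I * m, (hm.const_mul (-2 * Complex.I)).congr' ?_, ?_⟩
  · filter_upwards [self_mem_nhdsWithin] with r hr
    have hbase : Continuous fun t => ((1 + η ^ 2 * γ t ^ 2 : ℝ) : ℂ) ^ z := by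
      refine Continuous.cpow (by fun_prop) continuous_const fun t => Or.inl ?_
      rw [Complex.ofReal_re]
      positivity
    rw [setIntegral_abs_mem_Icc_eq ?_ hr, ← integral_const_mul]
    · refine setIntegral_congr_fun measurableSet_Icc fun t _ => ?_
      have hexp := exp_neg_mul_I_sub_exp_mul_I (2 * Real.pi * (ξ * t + η * γ t))
      have hθ : -(2 * Real.pi * (ξ * -t + η * γ (-t))) = 2 * Real.pi * (ξ * t + η * γ t) := by
        rw [hodd]
        ring
      have harg : 2 * Real.pi * ξ * t + 2 * Real.pi * (η * γ t) =
          2 * Real.pi * (ξ * t + η * γ t) := by ring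
      simp only [foldedIntegrand]
      rw [hθ, hodd t, neg_sq, mul_pow, harg, Complex.ofReal_neg t, div_neg, ← sub_eq_add_neg,
        ← sub_div, ← sub_mul, hexp]
      ring
    · exact ContinuousOn.div (Continuous.mul (by fun_prop) hbase).continuousOn
        Complex.continuous_ofReal.continuousOn fun t ht => Complex.ofReal_ne_zero.2 ht
  · have hnorm : ‖-2 * Complex.I * m‖ = 2 * ‖m‖ := by simp
    have hz_le : ‖z‖ ≤ |a| + |z.im| := hz ▸ Complex.norm_le_abs_re_add_abs_im z
    rw [hnorm]
    nlinarith [Real.pi_pos, abs_nonneg a, abs_nonneg z.im]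
end

section
/- For every z ∈ ℂ with Re z < −1, every ξ ∈ ℝ and every η ≠ 0, the two integrals J₁ = ∫_ℝ e^{−2πi(ξt + ηγ(t))} γ(t) (1 + η²γ(t)²)^z dt and J₂ = ∫_ℝ e^{−2πi(ξt + ηγ(t))} η γ(t)² (1 + η²γ(t)²)^{z−1} dt converge absolutely, and |−4π² ξ η J₁ − 4πi z ξ η J₂| ≤ C (1 + |Im z|)², where C depends only on Re z (not on ξ, η, Im z, or γ). (This quantity is |ξη ∂²m_z/∂ξ∂η (ξ,η)|, where m_z(ξ,η) = p.v. ∫_ℝ e^{−2πi(ξt + ηγ(t))} (1 + η²γ(t)²)^z dt/t.) -/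
open MeasureTheory Topology Filter

/-- One integration by parts on the half-line: the factor `ξ` is absorbed by the phase
`e^{-2πiξt}`, and the remaining integral is bounded by changing variables to `s = g t`. -/
theorem norm_mul_integral_Ioi_exp_mul_comp_le {g : ℝ → ℝ} {h h' : ℝ → ℂ} {K : ℝ → ℝ} (ξ : ℝ)
    (hg : Continuous g) (hg0 : g 0 = 0) (hgd : ∀ t, 0 < t → DifferentiableAt ℝ g t)
    (hinj : Set.InjOn g (Set.Ioi 0))
    (hh : ∀ s, HasDerivAt h (h' s) s) (hh' : Continuous h') (h0 : h 0 = 0)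
    (hK : Integrable K) (hbd : ∀ s, 2 * Real.pi * ‖h s‖ + ‖h' s‖ ≤ K s)
    (hhg : Integrable fun t => h (g t)) :
    ‖(ξ : ℂ) * ∫ t in Set.Ioi (0 : ℝ),
      Complex.exp (((-(2 * Real.pi * (ξ * t + g t)) : ℝ) : ℂ) * Complex.I) * h (g t)‖ ≤
      ∫ s, K s := by
  have hhc : Continuous h := continuous_iff_continuousAt.2 fun s => (hh s).continuousAt
  set e : ℝ → ℂ := fun t =>
    Complex.exp (((-(2 * Real.pi * (ξ * t + g t)) : ℝ) : ℂ) * Complex.I) with he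
  have hec : Continuous e := by fun_prop
  have hen : ∀ t, ‖e t‖ = 1 := fun t => Complex.norm_exp_ofReal_mul_I _
  have hK0 : ∀ s, 0 ≤ K s := fun s => le_trans (by positivity) (hbd s)
  have hhg' : Integrable fun t => e t * h (g t) := by
    refine hhg.norm.mono' (by fun_prop) (ae_of_all _ fun t => ?_)
    simp [hen]
  set R : ℝ → ℂ := fun t =>
    e t * ((deriv g t : ℝ) : ℂ) * (h' (g t) - 2 * Real.pi * Complex.I * h (g t)) with hR
  have hder : ∀ t ∈ Set.Ioi (0 : ℝ), HasDerivAt (fun t => e t * h (g t))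
      (R t - 2 * Real.pi * Complex.I * ξ * (e t * h (g t))) t := by
    intro t ht
    have hgt := (hgd t ht).hasDerivAt
    have h1 : HasDerivAt (fun t => -(2 * Real.pi * (ξ * t + g t)))
        (-(2 * Real.pi * (ξ * 1 + deriv g t))) t :=
      ((((hasDerivAt_id t).const_mul ξ).add hgt).const_mul (2 * Real.pi)).neg
    have h2 : HasDerivAt e _ t := (h1.ofReal_comp.mul_const Complex.I).cexp
    have h3 : HasDerivAt (fun t => h (g t)) _ t := (hh (g t)).scomp t hgt
    refine (h2.mul h3).congr_deriv ?_
    simp only [hR, he, Complex.real_smul]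
    push_cast
    ring
  have hmeas : MeasurableSet (Set.Ioi (0 : ℝ)) := measurableSet_Ioi
  have hKi : IntegrableOn (fun t => |deriv g t| • K (g t)) (Set.Ioi 0) :=
    (integrableOn_image_iff_integrableOn_abs_deriv_smul hmeas
      (fun t ht => (hgd t ht).hasDerivAt.hasDerivWithinAt) hinj K).1 hK.integrableOn
  have hRb : ∀ t, ‖R t‖ ≤ |deriv g t| • K (g t) := by
    intro t
    simp only [hR, norm_mul, hen, one_mul, Complex.norm_real, Real.norm_eq_abs, smul_eq_mul]
    gcongr
    refine (norm_sub_le _ _).trans (le_trans (le_of_eq ?_) (hbd (g t)))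
    simp [abs_of_pos Real.pi_pos]
    ring
  have hRm : Measurable R := by
    have := measurable_deriv g
    fun_prop
  have hRi : IntegrableOn R (Set.Ioi 0) :=
    hKi.mono' hRm.aestronglyMeasurable (ae_of_all _ hRb)
  have hdi : IntegrableOn (fun t => R t - 2 * Real.pi * Complex.I * ξ * (e t * h (g t)))
      (Set.Ioi 0) := hRi.sub (hhg'.integrableOn.const_mul _)
  have hlim := tendsto_zero_of_hasDerivAt_of_integrableOn_Ioi hder hdi hhg'.integrableOn
  have hparts := integral_Ioi_of_hasDerivAt_of_tendsto
    (by fun_prop : Continuous fun t => e t * h (g t)).continuousWithinAt hder hdi hlim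
  rw [integral_sub hRi (hhg'.integrableOn.const_mul _), integral_const_mul, hg0, h0, mul_zero,
    sub_zero, sub_eq_zero] at hparts
  have hle : ‖∫ t in Set.Ioi 0, R t‖ ≤ ∫ s, K s := calc
    _ ≤ ∫ t in Set.Ioi 0, |deriv g t| • K (g t) :=
      norm_integral_le_of_norm_le hKi (ae_of_all _ hRb)
    _ = ∫ s in g '' Set.Ioi 0, K s :=
      (integral_image_eq_integral_abs_deriv_smul hmeas
        (fun t ht => (hgd t ht).hasDerivAt.hasDerivWithinAt) hinj K).symm
    _ ≤ ∫ s, K s := setIntegral_le_integral hK (ae_of_all _ hK0)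
  rw [hparts, mul_assoc, norm_mul] at hle
  refine le_trans (le_mul_of_one_le_left (norm_nonneg _) ?_) hle
  simp only [norm_mul, Complex.norm_ofNat, Complex.norm_real, Real.norm_eq_abs, Complex.norm_I,
    abs_of_pos Real.pi_pos]
  linarith [Real.pi_gt_three]

/-- The whole-line version for odd `g`. -/
theorem norm_mul_integral_exp_mul_comp_le {g : ℝ → ℝ} {h h' : ℝ → ℂ} {K : ℝ → ℝ} (ξ : ℝ)
    (hg : Continuous g) (hodd : ∀ t, g (-t) = -g t)
    (hgd : ∀ t, 0 < t → DifferentiableAt ℝ g t) (hinj : Set.InjOn g (Set.Ioi 0))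
    (hh : ∀ s, HasDerivAt h (h' s) s) (hh' : Continuous h') (h0 : h 0 = 0)
    (hK : Integrable K) (hbd : ∀ s, 2 * Real.pi * ‖h s‖ + ‖h' s‖ ≤ K s)
    (hhg : Integrable fun t => h (g t)) :
    ‖(ξ : ℂ) * ∫ t : ℝ,
      Complex.exp (((-(2 * Real.pi * (ξ * t + g t)) : ℝ) : ℂ) * Complex.I) * h (g t)‖ ≤
      2 * ∫ s, K s := by
  have hhc : Continuous h := continuous_iff_continuousAt.2 fun s => (hh s).continuousAt
  have hg0 : g 0 = 0 := by
    have := hodd 0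
    rw [neg_zero] at this
    linarith
  have hhg' : Integrable fun t =>
      Complex.exp (((-(2 * Real.pi * (ξ * t + g t)) : ℝ) : ℂ) * Complex.I) * h (g t) := by
    refine hhg.norm.mono' (by fun_prop) (ae_of_all _ fun t => ?_)
    rw [norm_mul, Complex.norm_exp_ofReal_mul_I, one_mul]
  have hpos := norm_mul_integral_Ioi_exp_mul_comp_le ξ hg hg0 hgd hinj hh hh' h0 hK hbd hhg
  have hneg := norm_mul_integral_Ioi_exp_mul_comp_le (g := fun t => g (-t)) (-ξ)
    (by fun_prop) (by simpa using hg0)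
    (fun t ht => by simpa only [hodd] using (hgd t ht).fun_neg)
    (fun x hx y hy hxy => hinj hx hy (by simpa [hodd] using hxy)) hh hh' h0 hK hbd hhg.comp_neg
  have hflip : ∫ t in Set.Ioi (0 : ℝ), Complex.exp
      (((-(2 * Real.pi * (-ξ * t + g (-t))) : ℝ) : ℂ) * Complex.I) * h (g (-t)) =
      ∫ t in Set.Iic (0 : ℝ), Complex.exp
      (((-(2 * Real.pi * (ξ * t + g t)) : ℝ) : ℂ) * Complex.I) * h (g t) := by
    rw [← neg_zero, ← integral_comp_neg_Ioi, neg_zero]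
    simp only [mul_neg, neg_mul]
  rw [hflip, Complex.ofReal_neg, neg_mul, norm_neg] at hneg
  rw [← intervalIntegral.integral_Iic_add_Ioi hhg'.integrableOn hhg'.integrableOn, mul_add]
  linarith [norm_add_le_of_le hneg hpos]

theorem norm_one_add_sq_cpow (s : ℝ) (w : ℂ) :
    ‖((1 + s ^ 2 : ℝ) : ℂ) ^ w‖ = (1 + s ^ 2) ^ w.re :=
  Complex.norm_cpow_eq_rpow_re_of_pos (by positivity) w

theorem hasDerivAt_one_add_sq_cpow (s : ℝ) (w : ℂ) :
    HasDerivAt (fun s : ℝ => ((1 + s ^ 2 : ℝ) : ℂ) ^ w)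
      (w * ((1 + s ^ 2 : ℝ) : ℂ) ^ (w - 1) * (2 * s : ℝ)) s := by
  have h : HasDerivAt (fun s : ℝ => 1 + s ^ 2) (2 * s) s := by
    simpa using (hasDerivAt_pow 2 s).const_add 1
  have h2 : HasDerivAt (fun x : ℂ => x ^ w) (w * ((1 + s ^ 2 : ℝ) : ℂ) ^ (w - 1))
      ((1 + s ^ 2 : ℝ) : ℂ) :=
    (Complex.hasStrictDerivAt_cpow_const
      (Complex.ofReal_mem_slitPlane.2 (by positivity))).hasDerivAt
  exact h2.comp s h.ofReal_comp

theorem continuous_one_add_sq_cpow (w : ℂ) :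
    Continuous fun s : ℝ => ((1 + s ^ 2 : ℝ) : ℂ) ^ w :=
  continuous_iff_continuousAt.2 fun s => (hasDerivAt_one_add_sq_cpow s w).continuousAt

theorem abs_mul_one_add_sq_rpow_le (s b : ℝ) :
    |s| * (1 + s ^ 2) ^ b ≤ (1 + s ^ 2) ^ (b + 1 / 2) := by
  rw [Real.rpow_add (by positivity), mul_comm, ← Real.sqrt_eq_rpow]
  gcongr
  exact Real.abs_le_sqrt (by linarith)

theorem sq_mul_one_add_sq_rpow_le (s b : ℝ) :
    s ^ 2 * (1 + s ^ 2) ^ b ≤ (1 + s ^ 2) ^ (b + 1) := by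
  rw [Real.rpow_add_one (by positivity), mul_comm]
  gcongr
  linarith

theorem integrable_one_add_sq_rpow {b : ℝ} (hb : b < -1 / 2) :
    Integrable fun s : ℝ => (1 + s ^ 2) ^ b := by
  have h := integrable_rpow_neg_one_add_norm_sq (E := ℝ) (μ := volume) (r := -2 * b)
    (by simp; linarith)
  simpa [neg_div] using h

/-- A function growing at least linearly inherits the decay of `(1 + s²)^b`. -/
theorem exists_one_add_sq_comp_rpow_le {g : ℝ → ℝ} {c b : ℝ} (hc : 0 < c) (hb : b ≤ 0)
    (hg : ∀ t, 1 ≤ |t| → c * |t| ≤ |g t|) :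
    ∃ D, ∀ t, (1 + g t ^ 2) ^ b ≤ D * (1 + t ^ 2) ^ b := by
  set κ := min (1 / 2) (c ^ 2) with hκ
  have hκ0 : 0 < κ := by positivity
  have h1 : κ ≤ 1 / 2 := min_le_left _ _
  have h2 : κ ≤ c ^ 2 := min_le_right _ _
  refine ⟨κ ^ b, fun t => ?_⟩
  rw [← Real.mul_rpow hκ0.le (by positivity)]
  refine Real.rpow_le_rpow_of_nonpos (by positivity) ?_ hb
  rcases le_total 1 |t| with ht | ht
  · have h3 : (c * |t|) ^ 2 ≤ |g t| ^ 2 := by gcongr; exact hg t ht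
    rw [mul_pow, sq_abs, sq_abs] at h3
    nlinarith [sq_nonneg t]
  · have h3 : t ^ 2 ≤ 1 := by rw [← sq_abs]; nlinarith [abs_nonneg t]
    nlinarith [sq_nonneg (g t)]

theorem ConvexOn.mul_le_of_one_le {f : ℝ → ℝ} (hf : ConvexOn ℝ (Set.Ici 0) f) (h0 : f 0 = 0)
    {t : ℝ} (ht : 1 ≤ t) : f 1 * t ≤ f t := by
  have ht0 : 0 < t := by linarith
  have h := hf.2 (Set.mem_Ici.2 le_rfl) (Set.mem_Ici.2 ht0.le)
    (sub_nonneg.2 (inv_le_one_of_one_le₀ ht)) (inv_nonneg.2 ht0.le) (sub_add_cancel _ _)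
  simp only [smul_eq_mul, mul_zero, zero_add, inv_mul_cancel₀ ht0.ne', h0] at h
  rwa [inv_mul_eq_div, le_div_iff₀ ht0] at h

theorem norm_ofReal_mul_one_add_sq_cpow_le (s : ℝ) (z : ℂ) :
    ‖(s : ℂ) * ((1 + s ^ 2 : ℝ) : ℂ) ^ z‖ ≤ (1 + s ^ 2) ^ (z.re + 1 / 2) := by
  rw [norm_mul, norm_one_add_sq_cpow, Complex.norm_real, Real.norm_eq_abs]
  exact abs_mul_one_add_sq_rpow_le s _

theorem norm_sq_mul_one_add_sq_cpow_le (s : ℝ) (z : ℂ) :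
    ‖((s ^ 2 : ℝ) : ℂ) * ((1 + s ^ 2 : ℝ) : ℂ) ^ (z - 1)‖ ≤ (1 + s ^ 2) ^ (z.re + 1 / 2) := by
  rw [norm_mul, norm_one_add_sq_cpow, Complex.norm_real, Real.norm_eq_abs, abs_sq]
  refine (sq_mul_one_add_sq_rpow_le s _).trans
    (Real.rpow_le_rpow_of_exponent_le (by nlinarith [sq_nonneg s]) ?_)
  simp

theorem hasDerivAt_ofReal_mul_one_add_sq_cpow (s : ℝ) (z : ℂ) :
    HasDerivAt (fun s : ℝ => (s : ℂ) * ((1 + s ^ 2 : ℝ) : ℂ) ^ z)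
      (((1 + s ^ 2 : ℝ) : ℂ) ^ z +
        2 * z * (((s ^ 2 : ℝ) : ℂ) * ((1 + s ^ 2 : ℝ) : ℂ) ^ (z - 1))) s := by
  refine ((hasDerivAt_id s).ofReal_comp.mul (hasDerivAt_one_add_sq_cpow s z)).congr_deriv ?_
  simp only [id, Complex.ofReal_one]
  push_cast
  ring

theorem hasDerivAt_sq_mul_one_add_sq_cpow (s : ℝ) (z : ℂ) :
    HasDerivAt (fun s : ℝ => ((s ^ 2 : ℝ) : ℂ) * ((1 + s ^ 2 : ℝ) : ℂ) ^ (z - 1))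
      ((2 * s : ℝ) * (((1 + s ^ 2 : ℝ) : ℂ) ^ (z - 1) +
        (z - 1) * (((s ^ 2 : ℝ) : ℂ) * ((1 + s ^ 2 : ℝ) : ℂ) ^ (z - 1 - 1)))) s := by
  have h : HasDerivAt (fun s : ℝ => s ^ 2) (2 * s) s := by simpa using hasDerivAt_pow 2 s
  refine (h.ofReal_comp.mul (hasDerivAt_one_add_sq_cpow s (z - 1))).congr_deriv ?_
  push_cast
  ring

theorem norm_deriv_ofReal_mul_one_add_sq_cpow_le (s : ℝ) (z : ℂ) :
    ‖((1 + s ^ 2 : ℝ) : ℂ) ^ z +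
      2 * z * (((s ^ 2 : ℝ) : ℂ) * ((1 + s ^ 2 : ℝ) : ℂ) ^ (z - 1))‖ ≤
      (1 + 2 * ‖z‖) * (1 + s ^ 2) ^ (z.re + 1 / 2) := by
  have h1 : ‖((1 + s ^ 2 : ℝ) : ℂ) ^ z‖ ≤ (1 + s ^ 2) ^ (z.re + 1 / 2) := by
    rw [norm_one_add_sq_cpow]
    exact Real.rpow_le_rpow_of_exponent_le (by nlinarith [sq_nonneg s]) (by linarith)
  refine (norm_add_le _ _).trans ?_
  rw [norm_mul, norm_mul, Complex.norm_ofNat, one_add_mul]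
  gcongr
  exact norm_sq_mul_one_add_sq_cpow_le s z

theorem norm_deriv_sq_mul_one_add_sq_cpow_le (s : ℝ) (z : ℂ) :
    ‖((2 * s : ℝ) : ℂ) * (((1 + s ^ 2 : ℝ) : ℂ) ^ (z - 1) +
      (z - 1) * (((s ^ 2 : ℝ) : ℂ) * ((1 + s ^ 2 : ℝ) : ℂ) ^ (z - 1 - 1)))‖ ≤
      (4 + 2 * ‖z‖) * (1 + s ^ 2) ^ (z.re + 1 / 2) := by
  have h1 : ‖((s ^ 2 : ℝ) : ℂ) * ((1 + s ^ 2 : ℝ) : ℂ) ^ (z - 1 - 1)‖ ≤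
      (1 + s ^ 2) ^ (z.re - 1) := by
    rw [norm_mul, norm_one_add_sq_cpow, Complex.norm_real, Real.norm_eq_abs, abs_sq]
    simpa using sq_mul_one_add_sq_rpow_le s (z.re - 1 - 1)
  have h2 : ‖z - 1‖ ≤ ‖z‖ + 1 := by simpa using norm_sub_le z 1
  have h3 : |s| * (1 + s ^ 2) ^ (z.re - 1) ≤ (1 + s ^ 2) ^ (z.re + 1 / 2) :=
    (abs_mul_one_add_sq_rpow_le s _).trans
      (Real.rpow_le_rpow_of_exponent_le (by nlinarith [sq_nonneg s]) (by linarith))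
  calc _ ≤ (2 * |s|) * ((1 + s ^ 2) ^ (z.re - 1) + (‖z‖ + 1) * (1 + s ^ 2) ^ (z.re - 1)) := by
        rw [norm_mul, Complex.norm_real, norm_mul, Real.norm_eq_abs, Real.norm_eq_abs, abs_two]
        gcongr
        refine (norm_add_le _ _).trans ?_
        rw [norm_one_add_sq_cpow, norm_mul (z - 1)]
        exact add_le_add (by simp) (mul_le_mul h2 h1 (norm_nonneg _) (by positivity))
    _ = (4 + 2 * ‖z‖) * (|s| * (1 + s ^ 2) ^ (z.re - 1)) := by ring
    _ ≤ _ := by gcongr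

/-- the bound `|ξη ∂²m_z/∂ξ∂η (ξ,η)| ≤ C (1 + |Im z|)²` for `Re z < −1`,
where `ξη ∂²m_z/∂ξ∂η (ξ,η) = −4π² ξη J₁ − 4πi z ξη J₂` with
`J₁ = ∫ e^{−2πi(ξt + ηγ(t))} γ(t) (1 + η²γ(t)²)^z dt` and
`J₂ = ∫ e^{−2πi(ξt + ηγ(t))} η γ(t)² (1 + η²γ(t)²)^{z−1} dt`, both absolutely
convergent; `C` depends only on `Re z` (not on `ξ`, `η`, `Im z`, or `γ`). -/
theorem mixed_derivative_multiplier_bound :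
    ∀ a : ℝ, a < -1 → ∃ C : ℝ, ∀ γ : ℝ → ℝ,
      Continuous γ → (∀ t, γ (-t) = -γ t) →
      ContDiffOn ℝ 2 γ (Set.Ici 0) →
      StrictMonoOn γ (Set.Ici 0) → ConvexOn ℝ (Set.Ici 0) γ →
      (MonotoneOn (deriv (deriv γ)) (Set.Ioi 0) ∨
        AntitoneOn (deriv (deriv γ)) (Set.Ioi 0)) →
      (∃ C₀ > (0:ℝ), ∀ t : ℝ, 0 < t → deriv γ t ≤ C₀ * t * deriv (deriv γ) t) →
      ∀ z : ℂ, z.re = a → ∀ ξ η : ℝ, η ≠ 0 →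
        Integrable (fun t : ℝ =>
          Complex.exp (((-(2 * Real.pi * (ξ * t + η * γ t)) : ℝ) : ℂ) * Complex.I) *
            ((γ t : ℝ) : ℂ) * ((1 + η ^ 2 * γ t ^ 2 : ℝ) : ℂ) ^ z) volume ∧
        Integrable (fun t : ℝ =>
          Complex.exp (((-(2 * Real.pi * (ξ * t + η * γ t)) : ℝ) : ℂ) * Complex.I) *
            ((η * γ t ^ 2 : ℝ) : ℂ) * ((1 + η ^ 2 * γ t ^ 2 : ℝ) : ℂ) ^ (z - 1)) volume ∧
        ‖(-(4 * Real.pi ^ 2 * (ξ : ℂ) * (η : ℂ))) * (∫ t : ℝ,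
            Complex.exp (((-(2 * Real.pi * (ξ * t + η * γ t)) : ℝ) : ℂ) * Complex.I) *
              ((γ t : ℝ) : ℂ) * ((1 + η ^ 2 * γ t ^ 2 : ℝ) : ℂ) ^ z) -
          4 * Real.pi * Complex.I * z * (ξ : ℂ) * (η : ℂ) * (∫ t : ℝ,
            Complex.exp (((-(2 * Real.pi * (ξ * t + η * γ t)) : ℝ) : ℂ) * Complex.I) *
              ((η * γ t ^ 2 : ℝ) : ℂ) *
                ((1 + η ^ 2 * γ t ^ 2 : ℝ) : ℂ) ^ (z - 1))‖ ≤
          C * (1 + |z.im|) ^ 2 := by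
  intro a ha
  set I : ℝ := ∫ s : ℝ, (1 + s ^ 2) ^ (a + 1 / 2) with hI
  have hI0 : 0 ≤ I := integral_nonneg fun s => by positivity
  have hIi := integrable_one_add_sq_rpow (b := a + 1 / 2) (by linarith)
  refine ⟨(4 * Real.pi ^ 2 + 4 * Real.pi * (1 + |a|)) *
    (2 * ((2 * Real.pi + 4 + 2 * (1 + |a|)) * I)), ?_⟩
  intro γ hγ hodd hsm hmono hconv _ _ z hz ξ η hη
  subst hz
  have hγ0 : γ 0 = 0 := by
    have := hodd 0
    rw [neg_zero] at this
    linarith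
  have hγ1 : 0 < γ 1 := hγ0 ▸ hmono Set.self_mem_Ici (Set.mem_Ici.2 zero_le_one) zero_lt_one
  set g : ℝ → ℝ := fun t => η * γ t with hg
  have hgc : Continuous g := by fun_prop
  have hgodd : ∀ t, g (-t) = -g t := fun t => by simp [hg, hodd]
  have hgd : ∀ t, 0 < t → DifferentiableAt ℝ g t := fun t ht =>
    ((hsm.contDiffAt (Ici_mem_nhds ht)).differentiableAt two_ne_zero).const_mul η
  have hinj : Set.InjOn g (Set.Ioi 0) := fun x hx y hy hxy =>
    hmono.injOn (Set.Ioi_subset_Ici_self hx) (Set.Ioi_subset_Ici_self hy)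
      (mul_left_cancel₀ hη hxy)
  have habs : ∀ t, |γ t| = |γ (|t|)| := fun t => by
    rcases abs_choice t with h | h <;> rw [h]
    rw [hodd, abs_neg]
  have hgrow : ∀ t, 1 ≤ |t| → |η| * γ 1 * |t| ≤ |g t| := fun t ht => by
    rw [abs_mul, habs, mul_assoc]
    gcongr
    exact (hconv.mul_le_of_one_le hγ0 ht).trans (le_abs_self _)
  obtain ⟨D, hD⟩ := exists_one_add_sq_comp_rpow_le (b := z.re + 1 / 2)
    (mul_pos (abs_pos.2 hη) hγ1) (by linarith) hgrow
  have hcomp : ∀ {h : ℝ → ℂ}, Continuous h →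
      (∀ s, ‖h s‖ ≤ (1 + s ^ 2) ^ (z.re + 1 / 2)) → Integrable fun t => h (g t) :=
    fun hc hb => (hIi.const_mul D).mono' (hc.comp hgc).aestronglyMeasurable
      (ae_of_all _ fun t => (hb (g t)).trans (hD t))
  have hc1 : Continuous fun s : ℝ => (s : ℂ) * ((1 + s ^ 2 : ℝ) : ℂ) ^ z :=
    Complex.continuous_ofReal.mul (continuous_one_add_sq_cpow z)
  have hc2 (w : ℂ) : Continuous fun s : ℝ =>
      ((s ^ 2 : ℝ) : ℂ) * ((1 + s ^ 2 : ℝ) : ℂ) ^ w :=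
    (Complex.continuous_ofReal.comp (continuous_pow 2)).mul (continuous_one_add_sq_cpow w)
  have hi1 := hcomp hc1 fun s => norm_ofReal_mul_one_add_sq_cpow_le s z
  have hi2 := hcomp (hc2 (z - 1)) fun s => norm_sq_mul_one_add_sq_cpow_le s z
  set B := 2 * Real.pi + 4 + 2 * ‖z‖ with hB
  have hb1 := norm_mul_integral_exp_mul_comp_le (K := fun s => B * (1 + s ^ 2) ^ (z.re + 1 / 2)) ξ
    hgc hgodd hgd hinj (fun s => hasDerivAt_ofReal_mul_one_add_sq_cpow s z)
    ((continuous_one_add_sq_cpow z).add (continuous_const.mul (hc2 (z - 1)))) (by simp)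
    (hIi.const_mul B) (fun s => by
      have h1 := mul_le_mul_of_nonneg_left (norm_ofReal_mul_one_add_sq_cpow_le s z)
        Real.two_pi_pos.le
      have h2 := norm_deriv_ofReal_mul_one_add_sq_cpow_le s z
      have h3 : 0 ≤ (1 + s ^ 2) ^ (z.re + 1 / 2) := by positivity
      simp only [hB]
      linarith) hi1
  have hb2 := norm_mul_integral_exp_mul_comp_le (K := fun s => B * (1 + s ^ 2) ^ (z.re + 1 / 2)) ξ
    hgc hgodd hgd hinj (fun s => hasDerivAt_sq_mul_one_add_sq_cpow s z)
    ((Complex.continuous_ofReal.comp (by fun_prop)).mul ((continuous_one_add_sq_cpow (z - 1)).add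
      (continuous_const.mul (hc2 (z - 1 - 1))))) (by simp)
    (hIi.const_mul B) (fun s => by
      have h1 := mul_le_mul_of_nonneg_left (norm_sq_mul_one_add_sq_cpow_le s z)
        Real.two_pi_pos.le
      have h2 := norm_deriv_sq_mul_one_add_sq_cpow_le s z
      simp only [hB]
      linarith) hi2
  rw [integral_const_mul, ← hI] at hb1 hb2
  set f₁ : ℝ → ℂ := fun t =>
    Complex.exp (((-(2 * Real.pi * (ξ * t + η * γ t)) : ℝ) : ℂ) * Complex.I) *
      ((γ t : ℝ) : ℂ) * ((1 + η ^ 2 * γ t ^ 2 : ℝ) : ℂ) ^ z with hf₁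
  set f₂ : ℝ → ℂ := fun t =>
    Complex.exp (((-(2 * Real.pi * (ξ * t + η * γ t)) : ℝ) : ℂ) * Complex.I) *
      ((η * γ t ^ 2 : ℝ) : ℂ) * ((1 + η ^ 2 * γ t ^ 2 : ℝ) : ℂ) ^ (z - 1) with hf₂
  have he₁ : (fun t => Complex.exp (((-(2 * Real.pi * (ξ * t + g t)) : ℝ) : ℂ) * Complex.I) *
      ((g t : ℂ) * ((1 + g t ^ 2 : ℝ) : ℂ) ^ z)) = fun t => η * f₁ t := by
    ext t
    simp only [hg, hf₁, mul_pow, Complex.ofReal_mul η (γ t)]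
    ring
  have he₂ : (fun t => Complex.exp (((-(2 * Real.pi * (ξ * t + g t)) : ℝ) : ℂ) * Complex.I) *
      (((g t ^ 2 : ℝ) : ℂ) * ((1 + g t ^ 2 : ℝ) : ℂ) ^ (z - 1))) = fun t => η * f₂ t := by
    ext t
    simp only [hg, hf₂, mul_pow]
    rw [show η ^ 2 * γ t ^ 2 = η * (η * γ t ^ 2) by ring, Complex.ofReal_mul η (η * γ t ^ 2)]
    ring
  have hphase {h : ℝ → ℂ} (hh : Integrable h) : Integrable fun t =>
      Complex.exp (((-(2 * Real.pi * (ξ * t + g t)) : ℝ) : ℂ) * Complex.I) * h t := by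
    refine hh.norm.mono' (AEStronglyMeasurable.mul (by fun_prop) hh.aestronglyMeasurable)
      (ae_of_all _ fun t => ?_)
    rw [norm_mul, Complex.norm_exp_ofReal_mul_I, one_mul]
  have hη_unit : IsUnit (η : ℂ) :=
    (Complex.ofReal_ne_zero.2 hη).isUnit
  refine ⟨(integrable_const_mul_iff hη_unit f₁).1 (he₁ ▸ hphase hi1),
    (integrable_const_mul_iff hη_unit f₂).1 (he₂ ▸ hphase hi2), ?_⟩
  rw [he₁, integral_const_mul] at hb1
  rw [he₂, integral_const_mul] at hb2
  set u := (ξ : ℂ) * (η * ∫ t, f₁ t)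
  set v := (ξ : ℂ) * (η * ∫ t, f₂ t)
  have hz : ‖z‖ ≤ (1 + |z.re|) * (1 + |z.im|) := by
    nlinarith [Complex.norm_le_abs_re_add_abs_im z, mul_nonneg (abs_nonneg z.re) (abs_nonneg z.im)]
  have hY : 1 ≤ 1 + |z.im| := by linarith [abs_nonneg z.im]
  have hπ := Real.pi_pos
  calc _ = ‖-(4 * Real.pi ^ 2 : ℂ) * u - 4 * Real.pi * Complex.I * z * v‖ := by
        congr 1
        ring
    _ ≤ 4 * Real.pi ^ 2 * ‖u‖ + 4 * Real.pi * ‖z‖ * ‖v‖ := by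
        refine (norm_sub_le _ _).trans (le_of_eq ?_)
        simp [abs_of_pos hπ]
    _ ≤ 4 * Real.pi ^ 2 * (2 * (B * I)) + 4 * Real.pi * ‖z‖ * (2 * (B * I)) := by gcongr
    _ = (4 * Real.pi ^ 2 * 1 + 4 * Real.pi * ‖z‖) *
        (2 * (((2 * Real.pi + 4) * 1 + 2 * ‖z‖) * I)) := by rw [hB]; ring
    _ ≤ (4 * Real.pi ^ 2 * (1 + |z.im|) + 4 * Real.pi * ((1 + |z.re|) * (1 + |z.im|))) *
        (2 * (((2 * Real.pi + 4) * (1 + |z.im|) + 2 * ((1 + |z.re|) * (1 + |z.im|))) * I)) := by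
      gcongr
    _ = _ := by ring
end
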